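/- arXiv:math/0006119 — 4 statements merged into one kernel-verified Lean document; each statement's English description precedes it below -/
import Mathlib

section
/- For all integers n ≥ 2 and r with 1 ≤ r and 2r ≤ n, and every nonnegative integer k, one has C(n,r)·‖P̃^{*k} − Ũ‖₂² = Σ_{i=1}^{r} [C(n,i) − C(n,i−1)]·(1 − i(n−i+1)/(r(n−r)))^{2k}, where P̃^{*k} is the probability measure induced on X by the k-fold convolution P^{*k}. -/
open scoped Classical Pointwise

noncomputable section

namespace BL

/-- The subgroup of permutations of `Fin n` mapping `{0,…,r−1}` (the "first r positions")
to itself. -/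
def blockSubgroup (n r : ℕ) : Subgroup (Equiv.Perm (Fin n)) :=
  MulAction.stabilizer (Equiv.Perm (Fin n)) ({ i : Fin n | (i : ℕ) < r } : Set (Fin n))

instance fintypeQuot {G : Type*} [Group G] [Fintype G] (H : Subgroup G) : Fintype (G ⧸ H) :=
  Fintype.ofFinite _

/-- Convolution of two (signed) measures on a finite group. -/
def conv {G : Type*} [Group G] [Fintype G] (μ ν : G → ℝ) : G → ℝ :=
  fun g => ∑ h : G, μ h * ν (h⁻¹ * g)

/-- `k`-fold convolution power; `convPow μ 0` is the point mass at the identity. -/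
def convPow {G : Type*} [Group G] [Fintype G] (μ : G → ℝ) : ℕ → G → ℝ
  | 0 => fun g => if g = 1 then 1 else 0
  | (k+1) => conv μ (convPow μ k)

/-- The measure induced on the left coset space `G ⧸ H`. -/
def induced {G : Type*} [Group G] [Fintype G] (H : Subgroup G) (μ : G → ℝ) :
    G ⧸ H → ℝ :=
  fun x => ∑ g : G, if (g : G ⧸ H) = x then μ g else 0

/-- Total variation distance. -/
def tv {X : Type*} [Fintype X] (μ ν : X → ℝ) : ℝ := (1/2) * ∑ x : X, |μ x - ν x|

/-- ℓ² distance. -/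
def l2 {X : Type*} [Fintype X] (μ ν : X → ℝ) : ℝ := Real.sqrt (∑ x : X, (μ x - ν x)^2)

/-- Uniform probability measure. -/
def unif (X : Type*) [Fintype X] : X → ℝ := fun _ => 1 / (Fintype.card X)

/-- `π = τκ` with `τ` a transposition crossing between the two blocks and `κ ∈ K`. -/
def crossProp (n r : ℕ) (π : Equiv.Perm (Fin n)) : Prop :=
  ∃ p q : Fin n, (p : ℕ) < r ∧ r ≤ (q : ℕ) ∧
    ∃ κ ∈ blockSubgroup n r, π = Equiv.swap p q * κ

/-- The Bernoulli–Laplace measure `P`. -/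
def P (n r : ℕ) : Equiv.Perm (Fin n) → ℝ := fun π =>
  if crossProp n r π then
    1 / ((r * (n - r) * (Nat.factorial r * Nat.factorial (n - r)) : ℕ) : ℝ)
  else 0

/-- The measure `Q` of the variant model. -/
def Q (n r : ℕ) : Equiv.Perm (Fin n) → ℝ := fun π =>
  if π ∈ blockSubgroup n r then
    ((n^2 - 2*r*(n-r) : ℕ) : ℝ) / ((n^2 * (Nat.factorial r * Nat.factorial (n - r)) : ℕ) : ℝ)
  else if crossProp n r π then
    2 / ((n^2 * (Nat.factorial r * Nat.factorial (n - r)) : ℕ) : ℝ)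
  else 0


section Johnson

open Finset Matrix Polynomial

variable {α : Type*}

theorem sum_powersetCard_eq [Fintype α] (r : ℕ) (f : Finset α → ℝ) :
    ∑ s : Set.powersetCard α r, f s = ∑ s ∈ powersetCard r univ, f s := by
  refine (Finset.sum_subtype _ (fun s => ?_) f).symm
  simp [Set.powersetCard.mem_iff]

theorem card_powersetCard_eq_choose [Fintype α] (r : ℕ) :
    Fintype.card (Set.powersetCard α r) = (Fintype.card α).choose r := by
  rw [← Nat.card_eq_fintype_card, Set.powersetCard.card, Nat.card_eq_fintype_card]

variable [DecidableEq α]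

/-- The adjacency matrix of the Johnson graph on the `r`-element subsets of `α`. -/
def johnson (α : Type*) [DecidableEq α] (r : ℕ) :
    Matrix (Set.powersetCard α r) (Set.powersetCard α r) ℝ :=
  fun s t => if ((s : Finset α) \ (t : Finset α)).card = 1 then 1 else 0

/-- The inclusion matrix between `r`-element and `(r + 1)`-element subsets of `α`. -/
def inclusion (α : Type*) [DecidableEq α] (r : ℕ) :
    Matrix (Set.powersetCard α r) (Set.powersetCard α (r + 1)) ℝ :=
  fun s t => if (s : Finset α) ⊆ (t : Finset α) then 1 else 0

theorem johnson_transpose (r : ℕ) : (johnson α r)ᵀ = johnson α r := by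
  ext s t
  rw [transpose_apply, johnson, johnson,
    card_sdiff_comm ((Set.powersetCard.card_eq t).trans (Set.powersetCard.card_eq s).symm)]

theorem johnson_smul_smul (r : ℕ) (g : Equiv.Perm α) (s t : Set.powersetCard α r) :
    johnson α r (g • s) (g • t) = johnson α r s t := by
  simp only [johnson, Set.powersetCard.coe_smul, ← smul_finset_sdiff, card_smul_finset]

variable [Fintype α]

theorem sum_ite_superset (r : ℕ) (u : Finset α) (hu : r ≤ u.card) :
    (∑ t : Set.powersetCard α (r + 1), if u ⊆ (t : Finset α) then (1 : ℝ) else 0) =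
      if u.card = r then (Fintype.card α : ℝ) - r else if u.card = r + 1 then 1 else 0 := by
  rw [sum_powersetCard_eq (r + 1) (fun t => if u ⊆ t then (1 : ℝ) else 0), sum_boole]
  split_ifs with h h'
  · have : #{t ∈ powersetCard (r + 1) univ | u ⊆ t} = #uᶜ := by
      symm
      refine card_bij (fun a _ => insert a u) ?_ ?_ ?_
      · intro a ha
        have ha : a ∉ u := by simpa using ha
        simp [card_insert_of_notMem ha, h, subset_insert]
      · intro a ha b hb hab
        have ha : a ∉ u := by simpa using ha
        have : a ∈ insert b u := hab ▸ mem_insert_self a u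
        simpa [ha] using this
      · intro t ht
        simp only [mem_filter, mem_powersetCard, subset_univ, true_and] at ht
        have hc : #(t \ u) = 1 := by rw [card_sdiff_of_subset ht.2]; omega
        obtain ⟨a, ha⟩ := card_eq_one.1 hc
        have hau : a ∈ t \ u := by simp [ha]
        refine ⟨a, by simpa using (mem_sdiff.1 hau).2, ?_⟩
        rw [insert_eq, ← ha, sdiff_union_of_subset ht.2]
    rw [this, card_compl, Nat.cast_sub (card_le_univ u), h]
  · have : ({t ∈ powersetCard (r + 1) univ | u ⊆ t} : Finset (Finset α)) = {u} := by
      ext t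
      simp only [mem_filter, mem_powersetCard, subset_univ, true_and, mem_singleton]
      exact ⟨fun ht => (eq_of_subset_of_card_le ht.2 (by omega)).symm,
        fun ht => by subst ht; exact ⟨h', subset_rfl⟩⟩
    simp [this]
  · have : ({t ∈ powersetCard (r + 1) univ | u ⊆ t} : Finset (Finset α)) = ∅ := by
      refine filter_eq_empty_iff.2 fun t ht hut => ?_
      have := card_le_card hut
      have := (mem_powersetCard.1 ht).2
      omega
    simp [this]

theorem sum_ite_subset (r : ℕ) (u : Finset α) (hu : u.card ≤ r + 1) :
    (∑ t : Set.powersetCard α r, if (t : Finset α) ⊆ u then (1 : ℝ) else 0) =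
      if u.card = r + 1 then (r : ℝ) + 1 else if u.card = r then 1 else 0 := by
  rw [sum_powersetCard_eq r (fun t => if t ⊆ u then (1 : ℝ) else 0), sum_boole]
  have : ({t ∈ powersetCard r univ | t ⊆ u} : Finset (Finset α)) = powersetCard r u := by
    ext t
    simp [mem_powersetCard, and_comm]
  rw [this, card_powersetCard]
  split_ifs with h h'
  · simp [h]
  · simp [h']
  · rw [Nat.choose_eq_zero_of_lt (by omega)]
    simp

theorem inclusion_mul_transpose (r : ℕ) :
    inclusion α r * (inclusion α r)ᵀ =
      johnson α r + algebraMap ℝ _ ((Fintype.card α : ℝ) - r) := by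
  ext s t
  have hs : #(s : Finset α) = r := Set.powersetCard.card_eq s
  have ht : #(t : Finset α) = r := Set.powersetCard.card_eq t
  have hc := card_sdiff_add_card (s : Finset α) (t : Finset α)
  have h := sum_ite_superset r ((s : Finset α) ∪ t) (by omega)
  simp only [Matrix.mul_apply, transpose_apply, inclusion, mul_ite, mul_one, mul_zero,
    ← ite_and, Matrix.add_apply, johnson, Matrix.algebraMap_matrix_apply, Algebra.algebraMap_self,
    RingHom.id_apply]
  simp only [union_subset_iff] at h
  have heq : s = t ↔ #((s : Finset α) ∪ t) = r := by
    rw [Set.powersetCard.eq_iff_subset, ← sdiff_eq_empty_iff_subset, ← card_eq_zero]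
    omega
  simp only [and_comm] at h ⊢
  rw [h]
  simp only [heq]
  split_ifs <;> first | omega | simp

theorem transpose_mul_inclusion (r : ℕ) :
    (inclusion α r)ᵀ * inclusion α r = johnson α (r + 1) + algebraMap ℝ _ ((r : ℝ) + 1) := by
  ext s t
  have hs : #(s : Finset α) = r + 1 := Set.powersetCard.card_eq s
  have ht : #(t : Finset α) = r + 1 := Set.powersetCard.card_eq t
  have hc := card_sdiff_add_card_inter (s : Finset α) (t : Finset α)
  have h := sum_ite_subset r ((s : Finset α) ∩ t) (by omega)
  simp only [Matrix.mul_apply, transpose_apply, inclusion, mul_ite, mul_one, mul_zero,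
    ← ite_and, Matrix.add_apply, johnson, Matrix.algebraMap_matrix_apply, Algebra.algebraMap_self,
    RingHom.id_apply]
  simp only [subset_inter_iff] at h
  have heq : s = t ↔ #((s : Finset α) ∩ t) = r + 1 := by
    rw [Set.powersetCard.eq_iff_subset, ← sdiff_eq_empty_iff_subset, ← card_eq_zero]
    omega
  simp only [and_comm] at h ⊢
  rw [h]
  simp only [heq]
  split_ifs <;> first | omega | simp

theorem johnson_mulVec_one (r : ℕ) (hr : 1 ≤ r) :
    johnson α r *ᵥ 1 = fun _ => (r : ℝ) * ((Fintype.card α : ℝ) - r) := by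
  obtain ⟨r, rfl⟩ := Nat.exists_eq_add_of_le' hr
  have hup : inclusion α r *ᵥ 1 = fun _ => (Fintype.card α : ℝ) - r := by
    ext s
    have := sum_ite_superset r (s : Finset α) (Set.powersetCard.card_eq s).ge
    simpa [mulVec, dotProduct, inclusion] using this
  have hdown : (inclusion α r)ᵀ *ᵥ 1 = fun _ => (r : ℝ) + 1 := by
    ext s
    have := sum_ite_subset r (s : Finset α) (Set.powersetCard.card_eq s).le
    simpa [mulVec, dotProduct, inclusion] using this
  have hj : johnson α (r + 1) =
      (inclusion α r)ᵀ * inclusion α r - algebraMap ℝ _ ((r : ℝ) + 1) := by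
    rw [transpose_mul_inclusion, add_sub_cancel_right]
  have hup' : inclusion α r *ᵥ 1 = ((Fintype.card α : ℝ) - r) • 1 := by
    rw [hup]
    ext
    simp
  rw [hj, sub_mulVec, ← mulVec_mulVec, hup', mulVec_smul, hdown, Algebra.algebraMap_eq_smul_one,
    smul_mulVec, one_mulVec]
  ext
  simp
  ring

theorem trace_aeval_mul_comm {m n : Type*} [Fintype m] [Fintype n] [DecidableEq m]
    [DecidableEq n] (A : Matrix m n ℝ) (B : Matrix n m ℝ) (q : ℝ[X]) :
    trace (aeval (A * B) q) =
      trace (aeval (B * A) q) + ((Fintype.card m : ℝ) - Fintype.card n) * q.eval 0 := by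
  induction q using Polynomial.induction_on' with
  | add p q hp hq =>
    simp only [map_add, trace_add, hp, hq, eval_add]
    ring
  | monomial k a =>
    rw [aeval_monomial, aeval_monomial, ← Algebra.smul_def, ← Algebra.smul_def, trace_smul,
      trace_smul]
    rcases k with _ | k
    · simp [trace_one]
      ring
    · have h : ∀ k : ℕ, (A * B) ^ (k + 1) = A * (B * A) ^ k * B := by
        intro k
        induction k with
        | zero => simp
        | succ k ih =>
          rw [pow_succ, ih, pow_succ]
          simp only [Matrix.mul_assoc]
      rw [h, trace_mul_comm, ← Matrix.mul_assoc, ← pow_succ']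
      simp

/-- The spectrum of the Johnson graph, in the form of a trace formula. -/
theorem trace_aeval_johnson (r : ℕ) (p : ℝ[X]) :
    trace (aeval (johnson α r) p) =
      p.eval ((r : ℝ) * ((Fintype.card α : ℝ) - r)) +
        ∑ i ∈ Icc 1 r, (((Fintype.card α).choose i : ℝ) - ((Fintype.card α).choose (i - 1) : ℝ)) *
          p.eval (((r : ℝ) - i) * ((Fintype.card α : ℝ) - r - i) - i) := by
  induction r generalizing p with
  | zero =>
    have h0 : johnson α 0 = algebraMap ℝ _ 0 := by
      ext s t
      have hs : (s : Finset α) = ∅ := card_eq_zero.1 (Set.powersetCard.card_eq s)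
      simp [johnson, hs]
    rw [h0, aeval_algebraMap_apply, Algebra.algebraMap_eq_smul_one, trace_smul, trace_one,
      card_powersetCard_eq_choose]
    simp
  | succ r ih =>
    have h₁ : johnson α (r + 1) =
        aeval ((inclusion α r)ᵀ * inclusion α r) (X - C ((r : ℝ) + 1)) := by
      rw [map_sub, aeval_X, aeval_C, transpose_mul_inclusion, add_sub_cancel_right]
    have h₂ : inclusion α r * (inclusion α r)ᵀ =
        aeval (johnson α r) (X + C ((Fintype.card α : ℝ) - r)) := by
      rw [map_add, aeval_X, aeval_C, inclusion_mul_transpose]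
    rw [h₁, ← aeval_comp, trace_aeval_mul_comm, h₂, ← aeval_comp, ih,
      card_powersetCard_eq_choose, card_powersetCard_eq_choose, sum_Icc_succ_top (by omega), add_assoc]
    simp only [eval_comp, eval_sub, eval_add, eval_X, eval_C, Nat.cast_add, Nat.cast_one,
      Nat.add_sub_cancel]
    congr 1
    · congr 1
      ring
    congr 1
    · refine sum_congr rfl fun i _ => ?_
      congr 2
      ring
    · congr 2
      ring

end Johnson

section Convolution

open Finset Matrix MulAction

theorem bijective_ofQuotientStabilizer {G X : Type*} [Group G] [MulAction G X]
    [IsPretransitive G X] (x₀ : X) : Function.Bijective (ofQuotientStabilizer G x₀) := by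
  refine ⟨injective_ofQuotientStabilizer G x₀, fun x => ?_⟩
  obtain ⟨a, rfl⟩ := exists_smul_eq G x₀ x
  exact ⟨a, rfl⟩

variable {G : Type*} [Group G] [Fintype G]

theorem sum_convPow_mul {X : Type*} [Fintype X] [DecidableEq X] [MulAction G X] {μ : G → ℝ}
    {T : Matrix X X ℝ} {x₀ : X}
    (hT : ∀ (F : X → ℝ) (a : G), ∑ g, μ g * F ((a * g) • x₀) = (T *ᵥ F) (a • x₀))
    (k : ℕ) (F : X → ℝ) (a : G) :
    ∑ g, convPow μ k g * F ((a * g) • x₀) = (T ^ k *ᵥ F) (a • x₀) := by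
  induction k generalizing a with
  | zero => simp [convPow]
  | succ k ih =>
    calc ∑ g, convPow μ (k + 1) g * F ((a * g) • x₀)
        = ∑ h, ∑ g, μ h * convPow μ k (h⁻¹ * g) * F ((a * g) • x₀) := by
          simp only [convPow, conv, sum_mul]
          exact sum_comm
      _ = ∑ h, μ h * ∑ g, convPow μ k g * F ((a * h * g) • x₀) := by
          refine sum_congr rfl fun h _ => ?_
          rw [mul_sum, ← Equiv.sum_comp (Equiv.mulLeft h)]
          simp [mul_assoc]
      _ = (T ^ (k + 1) *ᵥ F) (a • x₀) := by
          simp only [ih]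
          rw [hT (T ^ k *ᵥ F) a, mulVec_mulVec, ← pow_succ']

theorem sum_comp_smul {X : Type*} [Fintype X] [MulAction G X] [IsPretransitive G X]
    (x₀ : X) (F : X → ℝ) :
    (Fintype.card X : ℝ) * ∑ g : G, F (g • x₀) = Fintype.card G * ∑ x, F x := by
  have h (x : X) : ∑ g : G, F (g • x) = ∑ g : G, F (g • x₀) := by
    obtain ⟨a, rfl⟩ := exists_smul_eq G x₀ x
    rw [← Equiv.sum_comp (Equiv.mulRight a) (fun g => F (g • x₀))]
    simp [mul_smul]
  calc (Fintype.card X : ℝ) * ∑ g : G, F (g • x₀) = ∑ x, ∑ g : G, F (g • x) := by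
        simp [h]
    _ = ∑ g : G, ∑ x, F (g • x) := sum_comm
    _ = ∑ g : G, ∑ x, F x := sum_congr rfl fun g _ => Equiv.sum_comp (toPerm g) F
    _ = Fintype.card G * ∑ x, F x := by simp

theorem sum_quotient_stabilizer {X : Type*} [Fintype X] [DecidableEq X] [MulAction G X]
    [IsPretransitive G X] (x₀ : X) (μ : G → ℝ) (F : ℝ → ℝ) :
    ∑ x, F (induced (stabilizer G x₀) μ x) =
      ∑ x : X, F (∑ g, if g • x₀ = x then μ g else 0) := by
  refine Fintype.sum_bijective _ (bijective_ofQuotientStabilizer x₀) _ _ fun x => ?_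
  congr 1
  refine sum_congr rfl fun g _ => ?_
  have : (g : G ⧸ stabilizer G x₀) = x ↔ g • x₀ = ofQuotientStabilizer G x₀ x := by
    rw [← (injective_ofQuotientStabilizer G x₀).eq_iff, ofQuotientStabilizer_mk]
  simp only [this]

/-- If averaging against `μ` acts on a transitive `G`-set as a symmetric stochastic matrix `T`,
then the `ℓ²` distance to uniformity is given by the trace of the even powers of `T`. -/
theorem card_mul_l2_sq {X : Type*} [Fintype X] [DecidableEq X] [MulAction G X]
    [IsPretransitive G X] {μ : G → ℝ} {T : Matrix X X ℝ} {x₀ : X}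
    (hT : ∀ (F : X → ℝ) (a : G), ∑ g, μ g * F ((a * g) • x₀) = (T *ᵥ F) (a • x₀))
    (hsymm : Tᵀ = T) (hone : T *ᵥ 1 = 1) (k : ℕ) :
    (Fintype.card X : ℝ) * l2 (induced (stabilizer G x₀) (convPow μ k))
      (unif (G ⧸ stabilizer G x₀)) ^ 2 = trace (T ^ (2 * k)) - 1 := by
  have hentry (m : ℕ) (a : G) (x : X) :
      ∑ g, (if (a * g) • x₀ = x then convPow μ m g else 0) = (T ^ m) (a • x₀) x := by
    have := sum_convPow_mul hT m (Pi.single x 1) a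
    rw [mulVec_single_one] at this
    simpa [Pi.single_apply] using this
  have hone' : ∀ m : ℕ, T ^ m *ᵥ 1 = 1 := by
    intro m
    induction m with
    | zero => simp
    | succ m ih => rw [pow_succ, ← mulVec_mulVec, hone, ih]
  have hrow : ∑ x, (T ^ k) x₀ x = 1 := by
    have := congrFun (hone' k) x₀
    simpa [mulVec, dotProduct] using this
  have hdiag (x : X) : (T ^ (2 * k)) x x = (T ^ (2 * k)) x₀ x₀ := by
    obtain ⟨a, rfl⟩ := exists_smul_eq G x₀ x
    have h₁ := hentry (2 * k) a (a • x₀)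
    have h₂ := hentry (2 * k) 1 x₀
    simp only [mul_smul, one_smul, smul_left_cancel_iff] at h₁ h₂
    rw [← h₁, h₂]
  have hsq : ∑ x, (T ^ k) x₀ x ^ 2 = (T ^ (2 * k)) x₀ x₀ := by
    rw [two_mul, pow_add, Matrix.mul_apply]
    refine sum_congr rfl fun x _ => ?_
    rw [sq]
    congr 1
    conv_rhs => rw [← hsymm, ← transpose_pow, transpose_apply]
  have hcard : Fintype.card (G ⧸ stabilizer G x₀) = Fintype.card X :=
    Fintype.card_of_bijective (bijective_ofQuotientStabilizer x₀)
  have hpos : (Fintype.card X : ℝ) ≠ 0 :=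
    Nat.cast_ne_zero.2 (Fintype.card_pos_iff.2 ⟨x₀⟩).ne'
  have hind (x : X) : ∑ g, (if g • x₀ = x then convPow μ k g else 0) = (T ^ k) x₀ x := by
    simpa using hentry k 1 x
  rw [l2, Real.sq_sqrt (sum_nonneg fun _ _ => sq_nonneg _)]
  simp only [unif, hcard]
  rw [sum_quotient_stabilizer x₀ (convPow μ k) (fun y => (y - 1 / (Fintype.card X : ℝ)) ^ 2)]
  simp only [hind, sub_sq, sum_add_distrib, sum_sub_distrib, hsq, ← sum_mul, ← mul_sum, hrow,
    trace, diag_apply, hdiag, sum_const, card_univ, nsmul_eq_mul]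
  field_simp
  ring

end Convolution

section BernoulliLaplace

open Finset Matrix MulAction

/-- The set of the first `r` positions, as an `r`-element subset of `Fin n`. -/
def firstBlock {n r : ℕ} (h : r ≤ n) : Set.powersetCard (Fin n) r :=
  Set.powersetCard.ofCard (s := {i : Fin n | (i : ℕ) < r}) (by
    rw [Fin.card_filter_val_lt, min_eq_right h])

theorem mem_firstBlock {n r : ℕ} (h : r ≤ n) (i : Fin n) :
    i ∈ (firstBlock h : Finset (Fin n)) ↔ (i : ℕ) < r := by
  simp [firstBlock]

theorem blockSubgroup_eq_stabilizer {n r : ℕ} (h : r ≤ n) :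
    blockSubgroup n r = stabilizer (Equiv.Perm (Fin n)) (firstBlock h) := by
  rw [Set.powersetCard.stabilizer_coe, blockSubgroup]
  congr 1
  ext i
  exact (mem_firstBlock h i).symm

theorem crossProp_iff {n r : ℕ} (h : r ≤ n) (π : Equiv.Perm (Fin n)) :
    crossProp n r π ↔
      #((firstBlock h : Finset (Fin n)) \ (π • firstBlock h : Set.powersetCard (Fin n) r)) = 1 := by
  constructor
  · rintro ⟨p, q, hp, hq, κ, hκ, rfl⟩
    rw [blockSubgroup_eq_stabilizer h, mem_stabilizer_iff] at hκ
    rw [mul_smul, hκ, card_eq_one]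
    refine ⟨p, ?_⟩
    ext i
    rw [Set.powersetCard.coe_smul, mem_sdiff, ← inv_smul_mem_iff, Equiv.swap_inv,
      Equiv.Perm.smul_def, mem_firstBlock, mem_firstBlock, mem_singleton, Equiv.swap_apply_def]
    split_ifs with h₁ h₂
    · subst h₁; simp [hp, hq]
    · subst h₂; simp [hp, h₁]
    · simp [h₁]
  · intro hc
    have hc' := hc
    rw [card_sdiff_comm ((Set.powersetCard.card_eq _).trans (Set.powersetCard.card_eq _).symm)]
      at hc'
    obtain ⟨p, hp⟩ := card_eq_one.1 hc
    obtain ⟨q, hq⟩ := card_eq_one.1 hc'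
    simp only [Finset.ext_iff, mem_sdiff, mem_singleton] at hp hq
    obtain ⟨hp₁, hp₂⟩ := (hp p).2 rfl
    obtain ⟨hq₁, hq₂⟩ := (hq q).2 rfl
    refine ⟨p, q, (mem_firstBlock h p).1 hp₁, not_lt.1 fun hlt => hq₂ ((mem_firstBlock h q).2 hlt),
      Equiv.swap p q * π, ?_, by rw [← mul_assoc, Equiv.swap_mul_self, one_mul]⟩
    rw [blockSubgroup_eq_stabilizer h, mem_stabilizer_iff, mul_smul]
    refine Subtype.ext (Finset.ext fun i => ?_)
    rw [Set.powersetCard.coe_smul, ← inv_smul_mem_iff, Equiv.swap_inv, Equiv.Perm.smul_def,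
      Equiv.swap_apply_def]
    split_ifs with h₁ h₂
    · subst h₁; exact iff_of_true hq₁ hp₁
    · subst h₂; exact iff_of_false hp₂ hq₂
    · have := hp i
      have := hq i
      tauto

theorem sum_P_mul {n r : ℕ} (h : r ≤ n) (F : Set.powersetCard (Fin n) r → ℝ)
    (a : Equiv.Perm (Fin n)) :
    ∑ g, P n r g * F ((a * g) • firstBlock h) =
      ((((r : ℝ) * ((n : ℝ) - r))⁻¹ • johnson (Fin n) r) *ᵥ F) (a • firstBlock h) := by
  have := Set.powersetCard.isPretransitive (α := Fin n) (n := r)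
  have hcard : Fintype.card (Set.powersetCard (Fin n) r) = n.choose r := by
    rw [card_powersetCard_eq_choose, Fintype.card_fin]
  have hP (g : Equiv.Perm (Fin n)) : P n r g * F ((a * g) • firstBlock h) =
      1 / ((r * (n - r) * (r.factorial * (n - r).factorial) : ℕ) : ℝ) *
        (johnson (Fin n) r (a • firstBlock h) (a • g • firstBlock h) *
          F (a • g • firstBlock h)) := by
    rw [johnson_smul_smul, mul_smul, johnson, P]
    simp only [crossProp_iff h]
    split_ifs <;> simp
  have hsum := sum_comp_smul (G := Equiv.Perm (Fin n)) (firstBlock h) fun s =>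
    johnson (Fin n) r (a • firstBlock h) (a • s) * F (a • s)
  have hshift : ∑ s, johnson (Fin n) r (a • firstBlock h) (a • s) * F (a • s) =
      (johnson (Fin n) r *ᵥ F) (a • firstBlock h) :=
    Equiv.sum_comp (toPerm a) fun s => johnson (Fin n) r (a • firstBlock h) s * F s
  rw [hcard, hshift, Fintype.card_perm, Fintype.card_fin,
    ← Nat.choose_mul_factorial_mul_factorial h] at hsum
  have hchoose : (n.choose r : ℝ) ≠ 0 := Nat.cast_ne_zero.2 (Nat.choose_pos h).ne'
  have hr : (r.factorial : ℝ) ≠ 0 := Nat.cast_ne_zero.2 r.factorial_ne_zero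
  have hnr : ((n - r).factorial : ℝ) ≠ 0 := Nat.cast_ne_zero.2 (n - r).factorial_ne_zero
  push_cast at hsum
  rw [mul_assoc, mul_assoc, mul_right_inj' hchoose] at hsum
  simp only [hP, ← mul_sum, hsum]
  rw [smul_mulVec, Pi.smul_apply, smul_eq_mul]
  push_cast [Nat.cast_sub h]
  rw [one_div, mul_inv, mul_inv (r.factorial : ℝ)]
  field_simp

end BernoulliLaplace

/-- the exact ℓ² formula
`C(n,r)·‖P̃^{*k} − Ũ‖₂² = Σ_{i=1}^{r} [C(n,i) − C(n,i−1)]·(1 − i(n−i+1)/(r(n−r)))^{2k}`. -/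
theorem bernoulli_laplace_l2_formula (n r : ℕ) (hn : 2 ≤ n) (hr : 1 ≤ r)
    (hrn : 2 * r ≤ n) (k : ℕ) :
    (n.choose r : ℝ) *
      (l2 (induced (blockSubgroup n r) (convPow (P n r) k))
          (unif (Equiv.Perm (Fin n) ⧸ blockSubgroup n r)))^2 =
    ∑ i ∈ Finset.Icc 1 r,
      ((n.choose i : ℝ) - (n.choose (i-1) : ℝ)) *
        (1 - ((i : ℝ) * ((n : ℝ) - i + 1)) / ((r : ℝ) * ((n : ℝ) - r)))^(2*k) := by
  have h : r ≤ n := by omega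
  have hr₀ : (r : ℝ) ≠ 0 := Nat.cast_ne_zero.2 (by omega)
  have hnr : (n : ℝ) - r ≠ 0 := by
    rw [← Nat.cast_sub h]
    exact Nat.cast_ne_zero.2 (by omega)
  have hc : (r : ℝ) * ((n : ℝ) - r) ≠ 0 := mul_ne_zero hr₀ hnr
  have := Set.powersetCard.isPretransitive (α := Fin n) (n := r)
  have hcard : Fintype.card (Set.powersetCard (Fin n) r) = n.choose r := by
    rw [card_powersetCard_eq_choose, Fintype.card_fin]
  have hone : (((r : ℝ) * ((n : ℝ) - r))⁻¹ • johnson (Fin n) r).mulVec 1 = 1 := by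
    rw [Matrix.smul_mulVec, johnson_mulVec_one r hr, Fintype.card_fin]
    exact funext fun _ => inv_mul_cancel₀ hc
  rw [blockSubgroup_eq_stabilizer h, ← hcard, card_mul_l2_sq (sum_P_mul h)
    (by rw [Matrix.transpose_smul, johnson_transpose]) hone k]
  have htrace := trace_aeval_johnson (α := Fin n) r
    ((Polynomial.C ((r : ℝ) * ((n : ℝ) - r))⁻¹ * Polynomial.X) ^ (2 * k))
  simp only [map_pow, map_mul, Polynomial.aeval_C, Polynomial.aeval_X, ← Algebra.smul_def,
    Polynomial.eval_pow, Polynomial.eval_mul, Polynomial.eval_C, Polynomial.eval_X,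
    Fintype.card_fin, inv_mul_cancel₀ hc, one_pow] at htrace
  rw [htrace, add_sub_cancel_left]
  refine Finset.sum_congr rfl fun i _ => ?_
  congr 2
  field_simp
  ring

end BL
end
end

section
/- There exists a universal constant a > 0 such that for all integers n ≥ 2 and r with 1 ≤ r and 2r ≤ n, and every real c > 0, one has (1/4)·Σ_{i=1}^{r} [C(n,i) − C(n,i−1)]·n^{−i(n−i+1)/n}·e^{−c·i(n−i+1)/n} ≤ a²·e^{−c}. -/
/-- Since `log x / x` is antitone for `x ≥ e`, the correction factor `n ^ (i (i - 1) / n)` is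
largest at `n = 2 i`, up to replacing `i - 1` by `i`. -/
theorem rpow_mul_sub_one_div_le {n i : ℕ} (hi : 1 ≤ i) (hin : 2 * i ≤ n) :
    (n : ℝ) ^ ((i : ℝ) * (i - 1) / n) ≤ (2 * i : ℝ) ^ ((i : ℝ) / 2) := by
  have hi' : (1 : ℝ) ≤ i := by exact_mod_cast hi
  have hin' : (2 * i : ℝ) ≤ n := by exact_mod_cast hin
  have hn : (0 : ℝ) < n := by linarith
  rcases hi.eq_or_lt with rfl | h2
  · simpa using Real.one_le_rpow (by norm_num : (1 : ℝ) ≤ 2) (by norm_num : (0 : ℝ) ≤ 2⁻¹)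
  have h2' : (2 : ℝ) ≤ i := by exact_mod_cast h2
  have he : Real.exp 1 ≤ 2 * i := by linarith [Real.exp_one_lt_d9]
  have hlog : Real.log n / n ≤ Real.log (2 * i) / (2 * i) :=
    Real.log_div_self_antitoneOn he (he.trans hin') hin'
  have hlog0 : 0 ≤ Real.log n / n := div_nonneg (Real.log_nonneg (by linarith)) hn.le
  rw [Real.rpow_def_of_pos hn, Real.rpow_def_of_pos (by linarith)]
  refine Real.exp_le_exp.mpr ?_
  calc Real.log n * ((i : ℝ) * (i - 1) / n)
      = (Real.log n / n) * (i * (i - 1)) := by ring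
    _ ≤ (Real.log n / n) * (i * i) := by gcongr; linarith
    _ ≤ (Real.log (2 * i) / (2 * i)) * (i * i) := by gcongr
    _ = Real.log (2 * i) * (i / 2) := by field_simp

theorem rpow_half_div_factorial_le {i : ℕ} (hi : 1 ≤ i) :
    (2 * i : ℝ) ^ ((i : ℝ) / 2) / i.factorial ≤
      ((8 * Real.exp 1) ^ i / i.factorial + (1 / 4 : ℝ) ^ i) / 2 := by
  have hi' : (1 : ℝ) ≤ i := by exact_mod_cast hi
  have hf : (0 : ℝ) < i.factorial := by exact_mod_cast i.factorial_pos
  set A : ℝ := (8 * Real.exp 1) ^ i / i.factorial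
  set B : ℝ := (1 / 4 : ℝ) ^ i
  have hsq : ((2 * i : ℝ) ^ ((i : ℝ) / 2)) ^ 2 = (2 * i) ^ i := by
    rw [← Real.rpow_natCast, ← Real.rpow_mul (by linarith), ← Real.rpow_natCast]
    congr 1
    push_cast
    ring
  have hexp : (i : ℝ) ^ i / i.factorial ≤ Real.exp 1 ^ i := by
    rw [← Real.exp_nat_mul, mul_one]
    exact Real.pow_div_factorial_le_exp _ (by linarith) i
  have hAB : ((2 * i : ℝ) ^ ((i : ℝ) / 2) / i.factorial) ^ 2 ≤ A * B := by
    calc ((2 * i : ℝ) ^ ((i : ℝ) / 2) / i.factorial) ^ 2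
        = 2 ^ i * ((i : ℝ) ^ i / i.factorial) / i.factorial := by
          rw [div_pow, hsq, mul_pow]
          field_simp
      _ ≤ 2 ^ i * Real.exp 1 ^ i / i.factorial := by gcongr
      _ = A * B := by
          rw [div_mul_eq_mul_div, ← mul_pow, ← mul_pow]
          congr 2
          ring
  refine le_of_sq_le_sq ?_ (by positivity)
  nlinarith [sq_nonneg (A - B)]

theorem choose_mul_rpow_le {n i : ℕ} (hi : 1 ≤ i) (hin : 2 * i ≤ n) :
    (n.choose i : ℝ) * (n : ℝ) ^ (-(((i : ℝ) * ((n : ℝ) - i + 1)) / n)) ≤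
      ((8 * Real.exp 1) ^ i / i.factorial + (1 / 4 : ℝ) ^ i) / 2 := by
  have hn : (0 : ℝ) < n := by exact_mod_cast (by omega : 0 < n)
  refine le_trans ?_ (rpow_half_div_factorial_le hi)
  have hexpo : -(((i : ℝ) * ((n : ℝ) - i + 1)) / n) = (i : ℝ) * (i - 1) / n - i := by
    field_simp
    ring
  rw [hexpo, Real.rpow_sub hn, Real.rpow_natCast]
  calc (n.choose i : ℝ) * ((n : ℝ) ^ ((i : ℝ) * (i - 1) / n) / (n : ℝ) ^ i)
      ≤ ((n : ℝ) ^ i / i.factorial) * ((2 * i : ℝ) ^ ((i : ℝ) / 2) / (n : ℝ) ^ i) := by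
        gcongr
        · exact Nat.choose_le_pow_div i n
        · exact rpow_mul_sub_one_div_le hi hin
    _ = (2 * i : ℝ) ^ ((i : ℝ) / 2) / i.factorial := by field_simp

theorem exp_neg_mul_le {n i : ℕ} (hi : 1 ≤ i) (hin : i ≤ n) {c : ℝ} (hc : 0 ≤ c) :
    Real.exp (-c * (((i : ℝ) * ((n : ℝ) - i + 1)) / n)) ≤ Real.exp (-c) := by
  have hi' : (1 : ℝ) ≤ i := by exact_mod_cast hi
  have hin' : (i : ℝ) ≤ n := by exact_mod_cast hin
  have h1 : 1 ≤ ((i : ℝ) * ((n : ℝ) - i + 1)) / n := by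
    rw [one_le_div (by linarith)]
    nlinarith
  exact Real.exp_le_exp.mpr (by nlinarith)

theorem summable_half_pow_div_factorial_add_geometric :
    Summable fun i : ℕ => ((8 * Real.exp 1) ^ i / i.factorial + (1 / 4 : ℝ) ^ i) / 2 :=
  ((Real.summable_pow_div_factorial _).add
    (summable_geometric_of_lt_one (by norm_num) (by norm_num))).div_const 2


/-- Diaconis–Shahshahani estimate: there is a universal constant
`a > 0` such that for all integers `n ≥ 2` and `r` with `1 ≤ r`, `2r ≤ n`, and every
real `c > 0`,
`(1/4)·Σ_{i=1}^{r} [C(n,i) − C(n,i−1)]·n^{−i(n−i+1)/n}·e^{−c·i(n−i+1)/n} ≤ a²·e^{−c}`. -/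
theorem diaconis_shahshahani_sum_bound :
    ∃ a : ℝ, 0 < a ∧
      ∀ (n r : ℕ), 2 ≤ n → 1 ≤ r → 2 * r ≤ n → ∀ c : ℝ, 0 < c →
        (1/4 : ℝ) * ∑ i ∈ Finset.Icc 1 r,
            ((n.choose i : ℝ) - (n.choose (i-1) : ℝ)) *
              (n : ℝ) ^ (-(((i : ℝ) * ((n : ℝ) - i + 1)) / n)) *
              Real.exp (-c * (((i : ℝ) * ((n : ℝ) - i + 1)) / n))
          ≤ a^2 * Real.exp (-c) := by
  set g : ℕ → ℝ := fun i => ((8 * Real.exp 1) ^ i / i.factorial + (1 / 4 : ℝ) ^ i) / 2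
  have hg : ∀ i, 0 ≤ g i := fun i => by positivity
  have hS : 0 ≤ ∑' i, g i := tsum_nonneg hg
  refine ⟨1 + ∑' i, g i, by linarith, fun n r _ _ hrn c hc => ?_⟩
  have hterm : ∀ i ∈ Finset.Icc 1 r,
      ((n.choose i : ℝ) - (n.choose (i-1) : ℝ)) *
        (n : ℝ) ^ (-(((i : ℝ) * ((n : ℝ) - i + 1)) / n)) *
        Real.exp (-c * (((i : ℝ) * ((n : ℝ) - i + 1)) / n)) ≤ g i * Real.exp (-c) := by
    intro i hi
    obtain ⟨hi1, hir⟩ := Finset.mem_Icc.mp hi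
    refine mul_le_mul ?_ (exp_neg_mul_le hi1 (by omega) hc.le) (Real.exp_nonneg _) (hg i)
    have hin : 2 * i ≤ n := by omega
    exact (mul_le_mul_of_nonneg_right (sub_le_self _ (Nat.cast_nonneg _))
      (by positivity)).trans (choose_mul_rpow_le hi1 hin)
  have hsum : ∑ i ∈ Finset.Icc 1 r, g i ≤ ∑' i, g i :=
    summable_half_pow_div_factorial_add_geometric.sum_le_tsum _ fun i _ => hg i
  calc _ ≤ (1/4 : ℝ) * ∑ i ∈ Finset.Icc 1 r, g i * Real.exp (-c) :=
        mul_le_mul_of_nonneg_left (Finset.sum_le_sum hterm) (by norm_num)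
    _ = (1/4 : ℝ) * (∑ i ∈ Finset.Icc 1 r, g i) * Real.exp (-c) := by
        rw [← Finset.sum_mul, mul_assoc]
    _ ≤ (1 + ∑' i, g i) ^ 2 * Real.exp (-c) := by
        gcongr
        nlinarith
end

section
/- There exists a universal constant a > 0 such that the following holds. For all integers n ≥ 2 and r with 1 ≤ r and 2r ≤ n, every real c > 0, and every positive integer k with k ≥ (1/4)·n·(log n + c), one has ‖Q̃^{*k} − Ũ‖_TV ≤ (1/2)·C(n,r)^{1/2}·‖Q̃^{*k} − Ũ‖₂ ≤ a·e^{−c/2}, where Q̃^{*k} is the probability measure induced on X by the k-fold convolution Q^{*k}. -/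
open scoped Classical Pointwise

noncomputable section

namespace BL

/-- The traces of `(AB)^m` and `(BA)^m` agree for positive `m`. -/
lemma trace_mul_pow_comm {p q : Type*} [Fintype p] [Fintype q] [DecidableEq p] [DecidableEq q]
    (A : Matrix p q ℝ) (B : Matrix q p ℝ) {m : ℕ} (hm : m ≠ 0) :
    ((A * B) ^ m).trace = ((B * A) ^ m).trace := by
  obtain ⟨m, rfl⟩ := Nat.exists_eq_succ_of_ne_zero hm
  have h : ∀ j : ℕ, (A * B) ^ (j + 1) = A * ((B * A) ^ j * B) := by
    intro j
    induction j with
    | zero => simp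
    | succ j ih => rw [pow_succ', ih, pow_succ' (B * A) j]; simp only [Matrix.mul_assoc]
  rw [Nat.succ_eq_add_one, h, Matrix.trace_mul_comm, Matrix.mul_assoc, pow_succ]

lemma trace_smul_one_add_pow {p : Type*} [Fintype p] [DecidableEq p] (a : ℝ)
    (A : Matrix p p ℝ) (m : ℕ) :
    ((a • (1 : Matrix p p ℝ) + A) ^ m).trace =
      a ^ m * Fintype.card p +
        ∑ j ∈ Finset.range m, a ^ j * m.choose j * (A ^ (m - j)).trace := by
  have hc : Commute (a • (1 : Matrix p p ℝ)) A := (Commute.one_left A).smul_left a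
  rw [hc.add_pow, Matrix.trace_sum, Finset.sum_range_succ, add_comm]
  congr 1
  · simp [smul_pow, Matrix.trace_smul, Matrix.trace_one]
  · refine Finset.sum_congr rfl fun j _ => ?_
    rw [smul_pow, one_pow, ← nsmul_eq_mul', Matrix.trace_smul, Matrix.smul_mul, one_mul,
      Matrix.trace_smul]
    simp only [nsmul_eq_mul, smul_eq_mul]
    ring

lemma trace_smul_one_add_mul_pow {p q : Type*} [Fintype p] [Fintype q] [DecidableEq p]
    [DecidableEq q] (a : ℝ) (A : Matrix p q ℝ) (B : Matrix q p ℝ) (m : ℕ) :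
    ((a • (1 : Matrix p p ℝ) + A * B) ^ m).trace =
      ((a • (1 : Matrix q q ℝ) + B * A) ^ m).trace +
        ((Fintype.card p : ℝ) - Fintype.card q) * a ^ m := by
  rw [trace_smul_one_add_pow, trace_smul_one_add_pow]
  have : ∀ j ∈ Finset.range m, a ^ j * m.choose j * ((A * B) ^ (m - j)).trace =
      a ^ j * m.choose j * ((B * A) ^ (m - j)).trace := by
    intro j hj
    rw [trace_mul_pow_comm A B (Nat.sub_ne_zero_of_lt (Finset.mem_range.mp hj))]
  rw [Finset.sum_congr rfl this]
  ring

/-- The `s`-element subsets of `Fin n`. -/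
abbrev Sub (n s : ℕ) : Type := {S : Finset (Fin n) // S.card = s}

lemma card_sub (n s : ℕ) : Fintype.card (Sub n s) = n.choose s := by
  simp

lemma sum_subset_indicator {n : ℕ} (s : ℕ) (V : Finset (Fin n)) :
    ∑ T : Sub n s, (if T.1 ⊆ V then (1 : ℝ) else 0) = V.card.choose s := by
  rw [← Finset.sum_subtype (Finset.powersetCard s Finset.univ) (by simp)
    (fun T => if T ⊆ V then (1 : ℝ) else 0), Finset.sum_boole, ← Finset.card_powersetCard]
  congr 2
  ext T
  simp [and_comm]

lemma sum_superset_indicator {n : ℕ} (s : ℕ) (hs : s ≤ n) (W : Finset (Fin n)) :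
    ∑ T : Sub n s, (if W ⊆ T.1 then (1 : ℝ) else 0) = (n - W.card).choose (n - s) := by
  rw [← Finset.sum_subtype (Finset.powersetCard s Finset.univ) (by simp)
    (fun T => if W ⊆ T then (1 : ℝ) else 0), Finset.sum_boole]
  have : (n - W.card).choose (n - s) = (Finset.powersetCard (n - s) Wᶜ).card := by
    rw [Finset.card_powersetCard, Finset.card_compl, Fintype.card_fin]
  rw [this]
  congr 1
  refine Finset.card_bij' (fun T _ => Tᶜ) (fun T _ => Tᶜ) ?_ ?_ ?_ ?_
  · intro T hT
    simp only [Finset.mem_filter, Finset.mem_powersetCard] at hT ⊢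
    simp [Finset.card_compl, hT.1.2, hT.2]
  · intro T hT
    simp only [Finset.mem_filter, Finset.mem_powersetCard] at hT ⊢
    refine ⟨⟨Finset.subset_univ _, ?_⟩, ?_⟩
    · rw [Finset.card_compl, hT.2, Fintype.card_fin]; omega
    · exact Finset.subset_compl_comm.mp hT.1
  · simp
  · simp

/-- The inclusion matrix between `s`-subsets and `(s+1)`-subsets. -/
def incl (n s : ℕ) : Matrix (Sub n (s + 1)) (Sub n s) ℝ :=
  fun S T => if T.1 ⊆ S.1 then 1 else 0

/-- The transition matrix of the variant model, on `s`-subsets of `Fin n`. -/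
def trans (n s : ℕ) : Matrix (Sub n s) (Sub n s) ℝ := fun S T =>
  if S = T then 1 - 2 * s * (n - s) / (n : ℝ) ^ 2
  else if (S.1 ∪ T.1).card = s + 1 then 2 / (n : ℝ) ^ 2 else 0

/-- The eigenvalues of the variant model. -/
def eig (n i : ℕ) : ℝ := 1 - 2 * i * (n - i + 1) / (n : ℝ) ^ 2

lemma incl_mul_transpose_apply (n s : ℕ) (S T : Sub n (s + 1)) :
    (incl n s * (incl n s).transpose) S T = (S.1 ∩ T.1).card.choose s := by
  rw [Matrix.mul_apply, ← sum_subset_indicator]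
  refine Finset.sum_congr rfl fun V _ => ?_
  simp only [incl, Matrix.transpose_apply, Finset.subset_inter_iff]
  split_ifs <;> simp_all

lemma transpose_mul_incl_apply (n s : ℕ) (hs : s + 1 ≤ n) (S T : Sub n s) :
    ((incl n s).transpose * incl n s) S T =
      (n - (S.1 ∪ T.1).card).choose (n - (s + 1)) := by
  rw [Matrix.mul_apply, ← sum_superset_indicator _ hs]
  refine Finset.sum_congr rfl fun V _ => ?_
  simp only [incl, Matrix.transpose_apply, Finset.union_subset_iff]
  split_ifs <;> simp_all

lemma lt_card_union {n s : ℕ} {S T : Sub n s} (h : S ≠ T) : s < (S.1 ∪ T.1).card := by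
  by_contra! hc
  have h1 := Finset.eq_of_subset_of_card_le (Finset.subset_union_left (s₁ := S.1) (s₂ := T.1))
    (by rw [S.2]; exact hc)
  have h2 := Finset.eq_of_subset_of_card_le (Finset.subset_union_right (s₁ := S.1) (s₂ := T.1))
    (by rw [T.2]; exact hc)
  exact h (Subtype.ext (h1.trans h2.symm))

lemma trans_succ_eq (n s : ℕ) (hs : s + 1 ≤ n) :
    trans n (s + 1) = eig n (s + 1) • (1 : Matrix _ _ ℝ) +
      ((2 / (n : ℝ) ^ 2) • incl n s) * (incl n s).transpose := by
  have hn : (n : ℝ) ≠ 0 := by norm_cast; omega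
  ext S T
  rw [Matrix.smul_mul, Matrix.add_apply, Matrix.smul_apply, Matrix.smul_apply,
    incl_mul_transpose_apply, Matrix.one_apply]
  have hc := Finset.card_union_add_card_inter S.1 T.1
  rw [S.2, T.2] at hc
  unfold trans eig
  by_cases h : S = T
  · subst h
    simp [S.2]
    field_simp
    ring
  · have hlt := lt_card_union h
    rw [if_neg h, if_neg h]
    by_cases h2 : (S.1 ∪ T.1).card = s + 1 + 1
    · have : (S.1 ∩ T.1).card = s := by omega
      simp [h2, this]
    · have : (S.1 ∩ T.1).card < s := by omega
      simp [h2, Nat.choose_eq_zero_of_lt this]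

lemma trans_eq (n s : ℕ) (hs : s + 1 ≤ n) :
    trans n s = eig n (s + 1) • (1 : Matrix _ _ ℝ) +
      (incl n s).transpose * ((2 / (n : ℝ) ^ 2) • incl n s) := by
  have hn : (n : ℝ) ≠ 0 := by norm_cast; omega
  ext S T
  rw [Matrix.mul_smul, Matrix.add_apply, Matrix.smul_apply, Matrix.smul_apply,
    transpose_mul_incl_apply _ _ hs, Matrix.one_apply]
  unfold trans eig
  by_cases h : S = T
  · subst h
    have : n - s = (n - (s + 1)) + 1 := by omega
    rw [Finset.union_self, S.2, this, Nat.choose_succ_self_right]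
    push_cast [Nat.cast_sub hs]
    simp
    field_simp
    ring
  · have hlt := lt_card_union h
    have hle : (S.1 ∪ T.1).card ≤ n := by simpa using Finset.card_le_univ (S.1 ∪ T.1)
    rw [if_neg h, if_neg h]
    by_cases h2 : (S.1 ∪ T.1).card = s + 1
    · simp [h2]
    · have : n - (S.1 ∪ T.1).card < n - (s + 1) := by omega
      simp [h2, Nat.choose_eq_zero_of_lt this]

lemma trace_trans_pow (n s m : ℕ) (hs : s ≤ n) :
    (trans n s ^ m).trace = 1 + ∑ i ∈ Finset.range s,
      ((n.choose (i + 1) : ℝ) - n.choose i) * eig n (i + 1) ^ m := by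
  induction s with
  | zero =>
    have : trans n 0 = 1 := by
      ext S T
      have : S = T := by
        have h1 := Finset.card_eq_zero.mp S.2
        have h2 := Finset.card_eq_zero.mp T.2
        exact Subtype.ext (h1.trans h2.symm)
      subst this
      simp [trans]
    rw [this, one_pow, Matrix.trace_one, card_sub]
    simp
  | succ s ih =>
    rw [trans_succ_eq n s hs, trace_smul_one_add_mul_pow, ← trans_eq n s hs, ih (by omega),
      Finset.sum_range_succ, card_sub, card_sub]
    ring

lemma sum_trans (n s : ℕ) (hs : s ≤ n) (S : Sub n s) : ∑ T, trans n s S T = 1 := by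
  obtain _ | s := s
  · have := trace_trans_pow n 0 1 hs
    have hu : ∀ T : Sub n 0, T = S := fun T => Subtype.ext
      ((Finset.card_eq_zero.mp T.2).trans (Finset.card_eq_zero.mp S.2).symm)
    rw [Finset.sum_congr rfl (fun T _ => by rw [← hu T])]
    simpa [Matrix.trace] using this
  · have hn : (n : ℝ) ≠ 0 := by norm_cast; omega
    have h1 : ∀ V : Sub n s, ∑ T : Sub n (s + 1), incl n s T V = (n : ℝ) - s := by
      intro V
      have h := sum_superset_indicator (s + 1) hs V.1
      have : n - s = (n - (s + 1)) + 1 := by omega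
      rw [V.2, this, Nat.choose_succ_self_right, ← this, Nat.cast_sub (by omega)] at h
      exact h
    have h2 : ∑ T, (incl n s * (incl n s).transpose) S T = (s + 1) * ((n : ℝ) - s) := by
      simp only [Matrix.mul_apply, Matrix.transpose_apply]
      rw [Finset.sum_comm]
      have : ∀ V : Sub n s, ∑ T, incl n s S V * incl n s T V =
          (if V.1 ⊆ S.1 then (1 : ℝ) else 0) * ((n : ℝ) - s) := by
        intro V
        rw [← Finset.mul_sum]
        by_cases hV : V.1 ⊆ S.1
        · rw [h1 V]; rfl
        · simp [incl, hV]
      rw [Finset.sum_congr rfl fun V _ => this V, ← Finset.sum_mul, sum_subset_indicator, S.2,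
        Nat.choose_succ_self_right]
      push_cast
      rfl
    rw [trans_succ_eq n s hs, Matrix.smul_mul]
    simp only [Matrix.add_apply, Matrix.smul_apply, Finset.sum_add_distrib, ← Finset.smul_sum, h2]
    simp [Matrix.one_apply, eig]
    field_simp
    ring

lemma log_mul_le_of_two_mul_le {n i : ℕ} (hi : 1 ≤ i) (h : 2 * i ≤ n) :
    Real.log n * (i * (i - 1) / n) ≤ i * Real.log (2 * i) / 2 := by
  have hn : (0 : ℝ) < n := by norm_cast; omega
  have hlog : 0 ≤ Real.log (2 * i) := Real.log_nonneg (by norm_cast; omega)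
  obtain rfl | hi2 := hi.eq_or_lt
  · rw [Nat.cast_one] at hlog ⊢
    rw [sub_self, mul_zero, zero_div, mul_zero, one_mul]
    exact div_nonneg hlog zero_le_two
  have hi4 : (4 : ℝ) ≤ 2 * i := by norm_cast; omega
  have hin : (2 * i : ℝ) ≤ n := by exact_mod_cast h
  have he : Real.exp 1 ≤ 4 := by have := Real.exp_one_lt_d9; linarith
  have key : Real.log n / n ≤ Real.log (2 * i) / (2 * i) :=
    Real.log_div_self_antitoneOn (Set.mem_Ici.mpr (he.trans hi4))
      (Set.mem_Ici.mpr (he.trans (hi4.trans hin))) hin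
  calc Real.log n * (i * (i - 1) / n) = Real.log n / n * (i * (i - 1)) := by ring
    _ ≤ Real.log (2 * i) / (2 * i) * (i * (i - 1)) := by
        apply mul_le_mul_of_nonneg_right key
        nlinarith
    _ = (i - 1) * Real.log (2 * i) / 2 := by
        have : (i : ℝ) ≠ 0 := by linarith
        field_simp
    _ ≤ _ := by nlinarith

lemma exp_div_factorial_le {i : ℕ} (hi : 1 ≤ i) :
    Real.exp (i * Real.log (2 * i) / 2) / i.factorial ≤
      ((8 * Real.exp 1) ^ i / i.factorial + (1 / 4) ^ i) / 2 := by
  have hi0 : (0 : ℝ) < 2 * i := by norm_cast; omega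
  have hf : (0 : ℝ) < i.factorial := by exact_mod_cast i.factorial_pos
  set b := Real.exp (i * Real.log (2 * i) / 2) / i.factorial with hb
  have hb2 : b ^ 2 = (2 * i) ^ i / (i.factorial : ℝ) ^ 2 := by
    rw [hb, div_pow, ← Real.exp_nat_mul, ← Real.rpow_natCast (2 * i : ℝ) i,
      Real.rpow_def_of_pos hi0]
    congr 2
    push_cast
    ring
  have hs : b ^ 2 ≤ (8 * Real.exp 1) ^ i / i.factorial * (1 / 4) ^ i := by
    have h1 : (i : ℝ) ^ i / i.factorial ≤ Real.exp 1 ^ i := by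
      rw [← Real.exp_nat_mul, mul_one]
      exact Real.pow_div_factorial_le_exp _ (by positivity) _
    calc b ^ 2 = 2 ^ i * ((i : ℝ) ^ i / i.factorial) / i.factorial := by
          rw [hb2, mul_pow]; field_simp
      _ ≤ 2 ^ i * Real.exp 1 ^ i / i.factorial := by gcongr
      _ = _ := by
          rw [div_mul_eq_mul_div, ← mul_pow, ← mul_pow]
          congr 2
          ring
  set x := (8 * Real.exp 1) ^ i / (i.factorial : ℝ)
  have hx : 0 ≤ x := by positivity
  have hy : (0 : ℝ) ≤ (1 / 4) ^ i := by positivity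
  apply le_of_sq_le_sq _ (by positivity)
  nlinarith [sq_nonneg (x - (1 / 4) ^ i)]

lemma choose_mul_eig_pow_le {n i k : ℕ} {c : ℝ} (hn : 2 ≤ n) (hi : 1 ≤ i) (h : 2 * i ≤ n)
    (hc : 0 < c) (hk : (1 / 4 : ℝ) * n * (Real.log n + c) ≤ k) :
    (n.choose i : ℝ) * eig n i ^ (2 * k) ≤
      Real.exp (-c) * (((8 * Real.exp 1) ^ i / i.factorial + (1 / 4) ^ i) / 2) := by
  have hn0 : (2 : ℝ) ≤ n := by exact_mod_cast hn
  have hi0 : (1 : ℝ) ≤ i := by exact_mod_cast hi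
  have hin : (2 * i : ℝ) ≤ n := by exact_mod_cast h
  have hf : (0 : ℝ) < i.factorial := by exact_mod_cast i.factorial_pos
  have hlog : 0 ≤ Real.log n := Real.log_nonneg (by linarith)
  set t : ℝ := i * (n - i + 1) / n with ht
  have ht1 : 1 ≤ t := by
    rw [ht, one_le_div (by linarith)]
    nlinarith
  have heig : eig n i = 1 - 2 * t / n := by
    rw [ht, eig]; field_simp
  have heig0 : 0 ≤ eig n i := by
    rw [eig, sub_nonneg, div_le_one (by positivity)]
    nlinarith
  have hpow : eig n i ^ (2 * k) ≤ Real.exp (-((Real.log n + c) * t)) := by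
    calc eig n i ^ (2 * k) ≤ Real.exp (-(2 * t / n)) ^ (2 * k) := by
          gcongr
          rw [heig]
          exact Real.one_sub_le_exp_neg _
      _ = Real.exp (-(4 * k / n * t)) := by
          rw [← Real.exp_nat_mul]
          congr 1
          push_cast
          ring
      _ ≤ _ := by
          gcongr
          rw [le_div_iff₀ (by linarith)]
          linarith
  have hchoose : (n.choose i : ℝ) ≤ Real.exp (Real.log n * i) / i.factorial := by
    refine (Nat.choose_le_pow_div i n).trans (le_of_eq ?_)
    rw [← Real.rpow_natCast (n : ℝ) i, Real.rpow_def_of_pos (by linarith)]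
  have hL := log_mul_le_of_two_mul_le hi h
  have hti : Real.log n * i - Real.log n * t = Real.log n * (i * (i - 1) / n) := by
    rw [ht]; field_simp; ring
  calc (n.choose i : ℝ) * eig n i ^ (2 * k)
      ≤ Real.exp (Real.log n * i) / i.factorial * Real.exp (-((Real.log n + c) * t)) := by
        gcongr
    _ = Real.exp (Real.log n * i + -((Real.log n + c) * t)) / i.factorial := by
        rw [Real.exp_add]; ring
    _ ≤ Real.exp (-c + i * Real.log (2 * i) / 2) / i.factorial := by
        refine div_le_div_of_nonneg_right (Real.exp_le_exp.mpr ?_) hf.le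
        nlinarith
    _ = Real.exp (-c) * (Real.exp (i * Real.log (2 * i) / 2) / i.factorial) := by
        rw [Real.exp_add]; ring
    _ ≤ _ := mul_le_mul_of_nonneg_left (exp_div_factorial_le hi) (Real.exp_pos _).le

lemma sum_eig_pow_le {n r k : ℕ} {c : ℝ} (hn : 2 ≤ n) (h : 2 * r ≤ n)
    (hc : 0 < c) (hk : (1 / 4 : ℝ) * n * (Real.log n + c) ≤ k) :
    ∑ i ∈ Finset.range r, ((n.choose (i + 1) : ℝ) - n.choose i) * eig n (i + 1) ^ (2 * k) ≤
      Real.exp (-c) * (Real.exp (8 * Real.exp 1) + 2) := by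
  have hterm : ∀ i ∈ Finset.range r,
      ((n.choose (i + 1) : ℝ) - n.choose i) * eig n (i + 1) ^ (2 * k) ≤
        Real.exp (-c) * (((8 * Real.exp 1) ^ (i + 1) / (i + 1).factorial
          + (1 / 4) ^ (i + 1)) / 2) := by
    intro i hi
    have hir := Finset.mem_range.mp hi
    refine le_trans ?_ (choose_mul_eig_pow_le hn (by omega) (by omega) hc hk)
    have : 0 ≤ eig n (i + 1) ^ (2 * k) := (even_two_mul k).pow_nonneg _
    have h0 : (0 : ℝ) ≤ n.choose i := by positivity
    nlinarith
  refine (Finset.sum_le_sum hterm).trans ?_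
  rw [← Finset.mul_sum]
  gcongr
  rw [← Finset.sum_div, Finset.sum_add_distrib]
  have h1 : ∑ i ∈ Finset.range r, (8 * Real.exp 1) ^ (i + 1) / ((i + 1).factorial : ℝ) ≤
      Real.exp (8 * Real.exp 1) := by
    refine le_trans ?_ (Real.sum_le_exp_of_nonneg (by positivity) (r + 1))
    rw [Finset.sum_range_succ']
    simp
  have h2 : ∑ i ∈ Finset.range r, (1 / 4 : ℝ) ^ (i + 1) ≤ 1 := by
    have hg : ∀ m : ℕ, ∑ i ∈ Finset.range m, (1 / 4 : ℝ) ^ (i + 1) = (1 - (1 / 4) ^ m) / 3 := by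
      intro m
      induction m with
      | zero => simp
      | succ m ih => rw [Finset.sum_range_succ, ih]; ring
    rw [hg]
    have : (0 : ℝ) ≤ (1 / 4) ^ r := by positivity
    linarith
  have := Real.exp_pos (8 * Real.exp 1)
  linarith

section Convolution

variable {G : Type*} [Group G] [Fintype G]

/-- The matrix of right convolution by `μ`. -/
def convMat (μ : G → ℝ) : Matrix G G ℝ := fun g h => μ (g⁻¹ * h)

lemma convMat_pow_apply [DecidableEq G] (μ : G → ℝ) (k : ℕ) (g h : G) :
    (convMat μ ^ k) g h = convPow μ k (g⁻¹ * h) := by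
  induction k generalizing g h with
  | zero => simp [convPow, Matrix.one_apply, inv_mul_eq_one]
  | succ k ih =>
    rw [pow_succ', Matrix.mul_apply, convPow, conv]
    refine Fintype.sum_equiv (Equiv.mulLeft g⁻¹) _ _ fun u => ?_
    simp [ih, convMat, mul_assoc]

lemma trace_convMat_pow [DecidableEq G] {μ : G → ℝ} (hμ : (convMat μ).IsSymm) (k : ℕ) :
    (convMat μ ^ (2 * k)).trace = Fintype.card G * ∑ g, convPow μ k g ^ 2 := by
  have hs : (convMat μ ^ k).IsSymm := hμ.pow k
  have h : ∀ g, (convMat μ ^ (2 * k)) g g = ∑ g, convPow μ k g ^ 2 := by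
    intro g
    rw [two_mul, pow_add, Matrix.mul_apply]
    refine Fintype.sum_equiv (Equiv.mulLeft g⁻¹) _ _ fun u => ?_
    rw [hs.apply g u, convMat_pow_apply, ← sq]
    rfl
  simp [Matrix.trace, h]

lemma sum_convPow {μ : G → ℝ} (hμ : ∑ g, μ g = 1) (k : ℕ) : ∑ g, convPow μ k g = 1 := by
  induction k with
  | zero => simp [convPow]
  | succ k ih =>
    simp only [convPow, conv]
    rw [Finset.sum_comm, ← hμ]
    refine Finset.sum_congr rfl fun h _ => ?_
    rw [← Finset.mul_sum, Fintype.sum_equiv (Equiv.mulLeft h⁻¹) (fun g => convPow μ k (h⁻¹ * g))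
      (convPow μ k) fun _ => rfl, ih, mul_one]

lemma convPow_succ_mul_right {μ : G → ℝ} {H : Subgroup G}
    (hμ : ∀ g, ∀ κ ∈ H, μ (g * κ) = μ g) (k : ℕ) (g : G) {κ : G} (hκ : κ ∈ H) :
    convPow μ (k + 1) (g * κ) = convPow μ (k + 1) g := by
  have h : ∀ g, convPow μ (k + 1) g = (convMat μ ^ (k + 1)) 1 g := by
    simp [convMat_pow_apply]
  rw [h, h, pow_succ, Matrix.mul_apply, Matrix.mul_apply]
  refine Finset.sum_congr rfl fun u _ => ?_
  rw [convMat, ← mul_assoc, hμ _ κ hκ, convMat]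

lemma sum_induced (H : Subgroup G) (μ : G → ℝ) : ∑ x, induced H μ x = ∑ g, μ g := by
  simp only [induced]
  rw [Finset.sum_comm]
  simp

lemma card_filter_mk_eq (H : Subgroup G) (g : G) :
    (Finset.univ.filter fun h : G => (h : G ⧸ H) = g).card = Nat.card H := by
  rw [← Fintype.card_subtype, ← Nat.card_eq_fintype_card]
  refine Nat.card_congr ⟨fun h => ⟨g⁻¹ * h.1, QuotientGroup.eq.mp h.2.symm⟩,
    fun κ => ⟨g * κ.1, by simp⟩, fun h => by simp, fun κ => by simp⟩

lemma sum_induced_sq {H : Subgroup G} {ν : G → ℝ} (hν : ∀ g, ∀ κ ∈ H, ν (g * κ) = ν g) :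
    ∑ x, induced H ν x ^ 2 = Nat.card H * ∑ g, ν g ^ 2 := by
  rw [← Finset.sum_fiberwise Finset.univ (fun g : G => (g : G ⧸ H)) (fun g => ν g ^ 2),
    Finset.mul_sum]
  refine Finset.sum_congr rfl fun x _ => ?_
  obtain ⟨g, rfl⟩ := QuotientGroup.mk_surjective x
  have hc : ∀ h ∈ Finset.univ.filter fun h : G => (h : G ⧸ H) = g, ν h = ν g := by
    intro h hh
    have := hν g _ (QuotientGroup.eq.mp (Finset.mem_filter.mp hh).2.symm)
    simpa using this
  rw [induced, ← Finset.sum_filter, Finset.sum_congr rfl hc,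
    Finset.sum_congr rfl fun h hh => congrArg (· ^ 2) (hc h hh), Finset.sum_const,
    Finset.sum_const, card_filter_mk_eq]
  simp only [nsmul_eq_mul]
  ring

end Convolution

lemma tv_le_l2 {X : Type*} [Fintype X] (μ ν : X → ℝ) :
    tv μ ν ≤ 1 / 2 * √(Fintype.card X) * l2 μ ν := by
  rw [tv, l2, mul_assoc, ← Real.sqrt_mul (by positivity)]
  gcongr
  apply Real.le_sqrt_of_sq_le
  simpa using sq_sum_le_card_mul_sum_sq (s := Finset.univ) (f := fun x => |μ x - ν x|)

lemma card_mul_sum_sub_unif_sq {X : Type*} [Fintype X] [Nonempty X] {μ : X → ℝ}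
    (hμ : ∑ x, μ x = 1) :
    Fintype.card X * ∑ x, (μ x - unif X x) ^ 2 = Fintype.card X * (∑ x, μ x ^ 2) - 1 := by
  have hX : (Fintype.card X : ℝ) ≠ 0 := by exact_mod_cast Fintype.card_ne_zero
  simp only [unif, sub_sq, Finset.sum_add_distrib, Finset.sum_sub_distrib, ← Finset.sum_mul,
    ← Finset.mul_sum, hμ]
  simp
  field_simp
  ring

/-- The image of the first `r` positions under a permutation. -/
def block {n r : ℕ} (hr : r ≤ n) (g : Equiv.Perm (Fin n)) : Sub n r :=
  ⟨(Finset.univ.filter fun i : Fin n => (i : ℕ) < r).map g.toEmbedding, by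
    rw [Finset.card_map, Fin.card_filter_val_lt]; omega⟩

lemma mem_block {n r : ℕ} (hr : r ≤ n) (g : Equiv.Perm (Fin n)) (x : Fin n) :
    x ∈ (block hr g).1 ↔ ((g⁻¹ x : Fin n) : ℕ) < r := by
  simp only [block, Finset.mem_map_equiv, Finset.mem_filter, Finset.mem_univ, true_and]
  rfl

lemma block_mul {n r : ℕ} (hr : r ≤ n) (g h : Equiv.Perm (Fin n)) :
    (block hr (g * h)).1 = (block hr h).1.map g.toEmbedding := by
  ext x
  rw [mem_block, Finset.mem_map_equiv, mem_block, mul_inv_rev]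
  rfl

lemma mem_blockSubgroup_iff {n r : ℕ} (hr : r ≤ n) (g : Equiv.Perm (Fin n)) :
    g ∈ blockSubgroup n r ↔ block hr g = block hr 1 := by
  rw [blockSubgroup, MulAction.mem_stabilizer_iff, Subtype.ext_iff, Finset.ext_iff, Set.ext_iff]
  refine forall_congr' fun x => ?_
  rw [mem_block, mem_block, Set.mem_smul_set_iff_inv_smul_mem]
  rfl

lemma inv_mul_mem_blockSubgroup_iff {n r : ℕ} (hr : r ≤ n) (g h : Equiv.Perm (Fin n)) :
    g⁻¹ * h ∈ blockSubgroup n r ↔ block hr g = block hr h := by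
  rw [mem_blockSubgroup_iff hr, Subtype.ext_iff, Subtype.ext_iff,
    ← Finset.map_inj (f := g.toEmbedding), ← block_mul, ← block_mul, mul_inv_cancel_left, mul_one,
    eq_comm]

lemma crossProp_iff_s4 {n r : ℕ} (hr : r ≤ n) (g : Equiv.Perm (Fin n)) :
    crossProp n r g ↔ ((block hr 1).1 ∪ (block hr g).1).card = r + 1 := by
  have h1 : ∀ x, x ∈ (block hr 1).1 ↔ (x : ℕ) < r := by
    intro x; rw [mem_block]; rfl
  constructor
  · rintro ⟨p, q, hp, hq, κ, hκ, rfl⟩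
    have hU : (block hr 1).1 ∪ (block hr (Equiv.swap p q * κ)).1 = insert q (block hr 1).1 := by
      rw [block_mul, (mem_blockSubgroup_iff hr κ).mp hκ]
      ext x
      rw [Finset.mem_union, Finset.mem_insert, Finset.mem_map_equiv, Equiv.symm_swap, h1, h1]
      have : p ≠ q := by rintro rfl; omega
      by_cases hxq : x = q
      · subst hxq; simp [hp]
      · by_cases hxp : x = p
        · subst hxp; simp [hp]
        · rw [Equiv.swap_apply_of_ne_of_ne hxp hxq]; simp [hxq]
    rw [hU, Finset.card_insert_of_notMem (by rw [h1]; omega), (block hr 1).2]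
  · intro hU
    have hs := Finset.card_sdiff_add_card (block hr g).1 (block hr 1).1
    have hs' := Finset.card_sdiff_add_card (block hr 1).1 (block hr g).1
    rw [Finset.union_comm, hU, (block hr 1).2] at hs
    rw [hU, (block hr g).2] at hs'
    obtain ⟨q, hq⟩ := Finset.card_eq_one.mp
      (show ((block hr g).1 \ (block hr 1).1).card = 1 by omega)
    obtain ⟨p, hp⟩ := Finset.card_eq_one.mp
      (show ((block hr 1).1 \ (block hr g).1).card = 1 by omega)
    have hq' : ∀ x, (x ∈ (block hr g).1 ∧ ¬ (x : ℕ) < r) ↔ x = q := by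
      intro x
      rw [← h1, ← Finset.mem_sdiff, hq, Finset.mem_singleton]
    have hp' : ∀ x : Fin n, ((x : ℕ) < r ∧ x ∉ (block hr g).1) ↔ x = p := by
      intro x
      rw [← h1, ← Finset.mem_sdiff, hp, Finset.mem_singleton]
    obtain ⟨hq1, hq2⟩ := (hq' q).mpr rfl
    obtain ⟨hp1, hp2⟩ := (hp' p).mpr rfl
    refine ⟨p, q, hp1, not_lt.mp hq2, Equiv.swap p q * g, ?_, by simp [← mul_assoc]⟩
    rw [mem_blockSubgroup_iff hr, Subtype.ext_iff, block_mul]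
    ext x
    rw [Finset.mem_map_equiv, Equiv.symm_swap, h1]
    by_cases hxq : x = q
    · subst hxq; simp [hp2, hq2]
    · by_cases hxp : x = p
      · subst hxp; simp [hp1, hq1]
      · rw [Equiv.swap_apply_of_ne_of_ne hxp hxq]
        have a := hq' x
        have b := hp' x
        tauto

lemma inv_mul_crossProp_iff {n r : ℕ} (hr : r ≤ n) (g h : Equiv.Perm (Fin n)) :
    crossProp n r (g⁻¹ * h) ↔ ((block hr g).1 ∪ (block hr h).1).card = r + 1 := by
  rw [crossProp_iff_s4 hr, ← Finset.card_map g.toEmbedding, Finset.map_union, ← block_mul,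
    ← block_mul, mul_inv_cancel_left, mul_one]

lemma card_filter_block_eq {n r : ℕ} (hr : r ≤ n) (S : Sub n r) :
    (Finset.univ.filter fun g => block hr g = S).card = Nat.card (blockSubgroup n r) := by
  obtain ⟨g, hg⟩ := Equiv.Perm.exists_map_finset_eq (block hr 1).1 S.1
    ((block hr 1).2.trans S.2.symm)
  have hg : block hr g = S := by
    apply Subtype.ext
    rw [← hg, ← block_mul, mul_one]
  rw [← card_filter_mk_eq _ g]
  congr 1
  ext h
  simp only [Finset.mem_filter, Finset.mem_univ, true_and]
  rw [eq_comm (a := (h : Equiv.Perm (Fin n) ⧸ blockSubgroup n r)), QuotientGroup.eq,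
    inv_mul_mem_blockSubgroup_iff hr, hg, eq_comm]

lemma choose_mul_card_blockSubgroup {n r : ℕ} (hr : r ≤ n) :
    n.choose r * Nat.card (blockSubgroup n r) = Fintype.card (Equiv.Perm (Fin n)) := by
  rw [← Finset.card_univ, Finset.card_eq_sum_card_fiberwise (f := block hr)
    (t := Finset.univ) (by simp)]
  simp_rw [card_filter_block_eq]
  simp

lemma card_blockSubgroup {n r : ℕ} (hr : r ≤ n) :
    Nat.card (blockSubgroup n r) = r.factorial * (n - r).factorial := by
  have h := choose_mul_card_blockSubgroup hr
  rw [Fintype.card_perm, Fintype.card_fin, ← Nat.choose_mul_factorial_mul_factorial hr,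
    mul_assoc] at h
  exact Nat.eq_of_mul_eq_mul_left (Nat.choose_pos hr) h

lemma card_quotient_blockSubgroup {n r : ℕ} (hr : r ≤ n) :
    Fintype.card (Equiv.Perm (Fin n) ⧸ blockSubgroup n r) = n.choose r := by
  have h := Subgroup.card_eq_card_quotient_mul_card_subgroup (blockSubgroup n r)
  rw [Nat.card_eq_fintype_card, ← choose_mul_card_blockSubgroup hr] at h
  rw [← Nat.card_eq_fintype_card]
  exact (Nat.eq_of_mul_eq_mul_right Nat.card_pos h).symm

lemma convMat_Q_apply {n r : ℕ} (hn : 0 < n) (hr : r ≤ n) (g h : Equiv.Perm (Fin n)) :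
    convMat (Q n r) g h =
      trans n r (block hr g) (block hr h) / Nat.card (blockSubgroup n r) := by
  have hle : 2 * r * (n - r) ≤ n ^ 2 := by
    obtain ⟨d, rfl⟩ := Nat.exists_eq_add_of_le hr
    rw [Nat.add_sub_cancel_left]
    nlinarith
  have hn0 : (n : ℝ) ≠ 0 := by exact_mod_cast hn.ne'
  rw [convMat, Q, trans, card_blockSubgroup hr]
  simp only [inv_mul_mem_blockSubgroup_iff hr, inv_mul_crossProp_iff hr]
  split_ifs
  · push_cast [Nat.cast_sub hle, Nat.cast_sub hr]
    field_simp
  · push_cast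
    field_simp
  · simp

/-- The indicator matrix of `block`. -/
def blockMat {n r : ℕ} (hr : r ≤ n) : Matrix (Equiv.Perm (Fin n)) (Sub n r) ℝ :=
  fun g S => if block hr g = S then 1 else 0

lemma blockMat_transpose_mul {n r : ℕ} (hr : r ≤ n) :
    (blockMat hr).transpose * blockMat hr =
      (Nat.card (blockSubgroup n r) : ℝ) • (1 : Matrix (Sub n r) (Sub n r) ℝ) := by
  ext S T
  rw [Matrix.mul_apply, Matrix.smul_apply, Matrix.one_apply]
  simp only [Matrix.transpose_apply, blockMat]
  by_cases h : S = T
  · subst h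
    rw [← card_filter_block_eq hr S, if_pos rfl, smul_eq_mul, mul_one, ← Finset.sum_boole]
    exact Finset.sum_congr rfl fun g _ => by split_ifs <;> simp
  · rw [if_neg h, smul_zero]
    refine Finset.sum_eq_zero fun g _ => ?_
    by_cases hg : block hr g = S
    · simp [hg, h]
    · simp [hg]

lemma convMat_Q_eq {n r : ℕ} (hn : 0 < n) (hr : r ≤ n) :
    convMat (Q n r) = blockMat hr *
      ((Nat.card (blockSubgroup n r) : ℝ)⁻¹ • (trans n r * (blockMat hr).transpose)) := by
  ext g h
  rw [convMat_Q_apply hn hr, Matrix.mul_apply]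
  simp [blockMat, Matrix.mul_apply, div_eq_inv_mul]

lemma trace_convMat_Q_pow {n r m : ℕ} (hn : 0 < n) (hr : r ≤ n) (hm : m ≠ 0) :
    (convMat (Q n r) ^ m).trace = (trans n r ^ m).trace := by
  have hK : (Nat.card (blockSubgroup n r) : ℝ) ≠ 0 := by exact_mod_cast Nat.card_pos.ne'
  rw [convMat_Q_eq hn hr, trace_mul_pow_comm _ _ hm, Matrix.smul_mul, Matrix.mul_assoc,
    blockMat_transpose_mul, Matrix.mul_smul, Matrix.mul_one, smul_smul, inv_mul_cancel₀ hK,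
    one_smul]

lemma convMat_Q_isSymm {n r : ℕ} (hn : 0 < n) (hr : r ≤ n) : (convMat (Q n r)).IsSymm := by
  ext g h
  rw [Matrix.transpose_apply, convMat_Q_apply hn hr, convMat_Q_apply hn hr, trans, trans,
    Finset.union_comm]
  simp only [eq_comm]

lemma Q_mul_right {n r : ℕ} (hn : 0 < n) (hr : r ≤ n) (g κ : Equiv.Perm (Fin n))
    (hκ : κ ∈ blockSubgroup n r) : Q n r (g * κ) = Q n r g := by
  have h : ∀ g, Q n r g = convMat (Q n r) 1 g := by simp [convMat]
  have hb : block hr (g * κ) = block hr g := by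
    rw [eq_comm, ← inv_mul_mem_blockSubgroup_iff hr]
    simpa using hκ
  rw [h, h, convMat_Q_apply hn hr, convMat_Q_apply hn hr, hb]

lemma sum_Q {n r : ℕ} (hn : 0 < n) (hr : r ≤ n) : ∑ g, Q n r g = 1 := by
  have hK : (Nat.card (blockSubgroup n r) : ℝ) ≠ 0 := by exact_mod_cast Nat.card_pos.ne'
  have h : ∀ g, Q n r g = trans n r (block hr 1) (block hr g) / Nat.card (blockSubgroup n r) := by
    intro g
    rw [← convMat_Q_apply hn hr]
    simp [convMat]
  rw [← sum_trans n r hr (block hr 1), ← Finset.sum_fiberwise Finset.univ (block hr)]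
  refine Finset.sum_congr rfl fun S _ => ?_
  rw [Finset.sum_congr rfl (g := fun _ => trans n r (block hr 1) S / Nat.card (blockSubgroup n r))
    fun g hg => by rw [h, (Finset.mem_filter.mp hg).2], Finset.sum_const, card_filter_block_eq,
    nsmul_eq_mul]
  field_simp

/-- The normalized squared `ℓ²` distance to uniformity as a spectral sum. -/
lemma choose_mul_sum_sq {n r k : ℕ} (hn : 0 < n) (hr : r ≤ n) (hk : 0 < k) :
    (n.choose r : ℝ) * ∑ x, (induced (blockSubgroup n r) (convPow (Q n r) k) x -
        unif (Equiv.Perm (Fin n) ⧸ blockSubgroup n r) x) ^ 2 =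
      ∑ i ∈ Finset.range r,
        ((n.choose (i + 1) : ℝ) - n.choose i) * eig n (i + 1) ^ (2 * k) := by
  have hG : (n.choose r : ℝ) * Nat.card (blockSubgroup n r) =
      Fintype.card (Equiv.Perm (Fin n)) := by exact_mod_cast choose_mul_card_blockSubgroup hr
  have hν : ∀ g, ∀ κ ∈ blockSubgroup n r,
      convPow (Q n r) k (g * κ) = convPow (Q n r) k g := by
    obtain ⟨k, rfl⟩ := Nat.exists_eq_succ_of_ne_zero hk.ne'
    exact fun g κ hκ => convPow_succ_mul_right (Q_mul_right hn hr) k g hκ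
  rw [← card_quotient_blockSubgroup hr, card_mul_sum_sub_unif_sq
    ((sum_induced _ _).trans (sum_convPow (sum_Q hn hr) k)), card_quotient_blockSubgroup hr,
    sum_induced_sq hν, ← mul_assoc, hG, ← trace_convMat_pow (convMat_Q_isSymm hn hr),
    trace_convMat_Q_pow hn hr (by omega), trace_trans_pow n r _ hr, add_sub_cancel_left]

/-- upper bound for the variant model.  There is a universal constant
`a > 0` such that for all `n ≥ 2`, `1 ≤ r`, `2r ≤ n`, all `c > 0` and all positive
integers `k ≥ (1/4)·n·(log n + c)`,
`‖Q̃^{*k} − Ũ‖_TV ≤ (1/2)·C(n,r)^{1/2}·‖Q̃^{*k} − Ũ‖₂ ≤ a·e^{−c/2}`. -/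
theorem variant_upper_bound :
    ∃ a : ℝ, 0 < a ∧
      ∀ (n r : ℕ), 2 ≤ n → 1 ≤ r → 2 * r ≤ n →
        ∀ c : ℝ, 0 < c → ∀ k : ℕ, 0 < k →
          (1/4 : ℝ) * n * (Real.log n + c) ≤ k →
          tv (induced (blockSubgroup n r) (convPow (Q n r) k))
              (unif (Equiv.Perm (Fin n) ⧸ blockSubgroup n r)) ≤
            (1/2) * Real.sqrt (n.choose r) *
              l2 (induced (blockSubgroup n r) (convPow (Q n r) k))
                (unif (Equiv.Perm (Fin n) ⧸ blockSubgroup n r)) ∧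
          (1/2) * Real.sqrt (n.choose r) *
              l2 (induced (blockSubgroup n r) (convPow (Q n r) k))
                (unif (Equiv.Perm (Fin n) ⧸ blockSubgroup n r)) ≤
            a * Real.exp (-c/2) := by
  refine ⟨√(Real.exp (8 * Real.exp 1) + 2), by positivity, ?_⟩
  intro n r hn _ h2r c hc k hk0 hk
  have hr : r ≤ n := by omega
  refine ⟨?_, ?_⟩
  · rw [← card_quotient_blockSubgroup hr]
    exact tv_le_l2 _ _
  · rw [l2, mul_assoc, ← Real.sqrt_mul (by positivity),
      choose_mul_sum_sq (by omega) hr hk0]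
    have h := Real.sqrt_le_sqrt (sum_eig_pow_le hn h2r hc hk)
    rw [Real.sqrt_mul (Real.exp_pos _).le, ← Real.exp_half] at h
    have h0 := Real.sqrt_nonneg (∑ i ∈ Finset.range r,
      ((n.choose (i + 1) : ℝ) - n.choose i) * eig n (i + 1) ^ (2 * k))
    linarith

end BL
end
end

section
/- For all integers n ≥ 2 and r with 1 ≤ r and 2r ≤ n, and every nonnegative integer k, one has C(n,r)·‖Q̃^{*k} − Ũ‖₂² ≥ (n−1)·(1 − 2/n)^{2k}, where Q̃^{*k} is the probability measure induced on X by the k-fold convolution Q^{*k}. -/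
open scoped Classical Pointwise

noncomputable section

namespace BL

/-- The indicator of the first `r` positions, centred to have sum zero. -/
def centredIndicator (n r : ℕ) (i : Fin n) : ℝ := (if (i : ℕ) < r then 1 else 0) - (r : ℝ) / n

lemma mem_blockSubgroup_iff_s5 {n r : ℕ} {κ : Equiv.Perm (Fin n)} :
    κ ∈ blockSubgroup n r ↔ ∀ i, ((κ i : Fin n) : ℕ) < r ↔ (i : ℕ) < r := by
  rw [blockSubgroup, MulAction.mem_stabilizer_set]
  rfl

lemma centredIndicator_comp_inv {n r : ℕ} {κ : Equiv.Perm (Fin n)} (hκ : κ ∈ blockSubgroup n r)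
    (i : Fin n) : centredIndicator n r (κ⁻¹ i) = centredIndicator n r i := by
  simp only [centredIndicator, mem_blockSubgroup_iff_s5.1 (inv_mem hκ) i]

lemma card_fin_lt {n r : ℕ} (h : r ≤ n) :
    (Finset.univ.filter fun i : Fin n => (i : ℕ) < r).card = r := by
  simp [Fin.card_filter_val_lt, h]

lemma card_fin_ge {n r : ℕ} (h : r ≤ n) :
    (Finset.univ.filter fun i : Fin n => r ≤ (i : ℕ)).card = n - r := by
  have h1 := Finset.card_filter_add_card_filter_not (s := (Finset.univ : Finset (Fin n)))
    (fun i : Fin n => (i : ℕ) < r)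
  simp only [not_lt, card_fin_lt h, Finset.card_univ, Fintype.card_fin] at h1
  omega

lemma sum_centredIndicator {n r : ℕ} (hn : 0 < n) (h : r ≤ n) :
    ∑ i, centredIndicator n r i = 0 := by
  have : (n : ℝ) ≠ 0 := by positivity
  simp only [centredIndicator, Finset.sum_sub_distrib, Finset.sum_boole, card_fin_lt h]
  simp
  field_simp
  simp

lemma natCard_blockSubgroup {n r : ℕ} (h : r ≤ n) :
    Nat.card (blockSubgroup n r) = r.factorial * (n - r).factorial := by
  have h1 := DomMulAct.stabilizer_card (fun i : Fin n => decide ((i : ℕ) < r))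
  rw [Fintype.prod_bool] at h1
  simp only [decide_eq_true_eq, decide_eq_false_iff_not, not_lt, Fintype.card_subtype,
    card_fin_lt h, card_fin_ge h] at h1
  rw [← h1, Nat.card_eq_fintype_card, Fintype.card_subtype]
  congr 1
  ext κ
  simp [mem_blockSubgroup_iff_s5, funext_iff]

lemma crossProp.notMem {n r : ℕ} {π : Equiv.Perm (Fin n)} (h : crossProp n r π) :
    π ∉ blockSubgroup n r := by
  obtain ⟨p, q, hp, hq, κ, hκ, rfl⟩ := h
  intro hm
  have := mem_blockSubgroup_iff_s5.1 ((Subgroup.mul_mem_cancel_right _ hκ).1 hm) p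
  rw [Equiv.swap_apply_left] at this
  omega

lemma swap_mul_injective {n r : ℕ} {p q p' q' : Fin n} {κ κ' : Equiv.Perm (Fin n)}
    (hp : (p : ℕ) < r) (hq : r ≤ (q : ℕ)) (hp' : (p' : ℕ) < r) (hq' : r ≤ (q' : ℕ))
    (hκ : κ ∈ blockSubgroup n r) (hκ' : κ' ∈ blockSubgroup n r)
    (h : Equiv.swap p q * κ = Equiv.swap p' q' * κ') : p = p' ∧ q = q' ∧ κ = κ' := by
  have hm : Equiv.swap p' q' * Equiv.swap p q ∈ blockSubgroup n r := by
    have : Equiv.swap p' q' * Equiv.swap p q = κ' * κ⁻¹ := by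
      rw [eq_mul_inv_iff_mul_eq, mul_assoc, h, Equiv.swap_mul_self_mul]
    rw [this]
    exact mul_mem hκ' (inv_mem hκ)
  rw [mem_blockSubgroup_iff_s5] at hm
  have h1 := hm p
  have h2 := hm q
  simp only [Equiv.Perm.mul_apply, Equiv.swap_apply_left, Equiv.swap_apply_right] at h1 h2
  have hqq : q = q' := by
    by_contra hne
    rw [Equiv.swap_apply_of_ne_of_ne (by rintro rfl; omega) hne] at h1
    omega
  have hpp : p = p' := by
    by_contra hne
    rw [Equiv.swap_apply_of_ne_of_ne hne (by rintro rfl; omega)] at h2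
    omega
  subst hqq hpp
  exact ⟨rfl, rfl, mul_left_cancel h⟩

lemma sum_crossProp {n r : ℕ} (φ : Equiv.Perm (Fin n) → ℝ) :
    ∑ π with crossProp n r π, φ π =
      ∑ p ∈ Finset.univ.filter (fun p : Fin n => (p : ℕ) < r),
        ∑ q ∈ Finset.univ.filter (fun q : Fin n => r ≤ (q : ℕ)),
        ∑ κ with κ ∈ blockSubgroup n r, φ (Equiv.swap p q * κ) := by
  simp_rw [← Finset.sum_product']
  symm
  refine Finset.sum_bij (fun x _ => Equiv.swap x.1 x.2.1 * x.2.2) ?_ ?_ ?_ ?_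
  · rintro ⟨p, q, κ⟩ h
    simp only [Finset.mem_product, Finset.mem_filter, Finset.mem_univ, true_and] at h ⊢
    exact ⟨p, q, h.1, h.2.1, κ, h.2.2, rfl⟩
  · rintro ⟨p, q, κ⟩ h ⟨p', q', κ'⟩ h' e
    simp only [Finset.mem_product, Finset.mem_filter, Finset.mem_univ, true_and] at h h'
    obtain ⟨rfl, rfl, rfl⟩ := swap_mul_injective h.1 h.2.1 h'.1 h'.2.1 h.2.2 h'.2.2 e
    rfl
  · intro π h
    obtain ⟨p, q, hp, hq, κ, hκ, rfl⟩ := (Finset.mem_filter.1 h).2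
    exact ⟨(p, q, κ), by simp [hp, hq, hκ], rfl⟩
  · intros; rfl

lemma sum_swap_centredIndicator {n r : ℕ} (h : r ≤ n) (i : Fin n) :
    ∑ p ∈ Finset.univ.filter (fun p : Fin n => (p : ℕ) < r),
        ∑ q ∈ Finset.univ.filter (fun q : Fin n => r ≤ (q : ℕ)),
        centredIndicator n r (Equiv.swap p q i) =
      r * (n - r) * centredIndicator n r i - n * centredIndicator n r i := by
  have key : ∀ p ∈ Finset.univ.filter (fun p : Fin n => (p : ℕ) < r),
      ∀ q ∈ Finset.univ.filter (fun q : Fin n => r ≤ (q : ℕ)),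
      centredIndicator n r (Equiv.swap p q i) =
        centredIndicator n r i - (if i = p then 1 else 0) + (if i = q then 1 else 0) := by
    intro p hp q hq
    simp only [Finset.mem_filter, Finset.mem_univ, true_and] at hp hq
    have hpq : p ≠ q := by rintro rfl; omega
    by_cases h1 : i = p
    · subst h1
      simp [centredIndicator, hp, hpq, not_lt.2 hq]
    · by_cases h2 : i = q
      · subst h2
        simp [centredIndicator, hp, hpq.symm, not_lt.2 hq]
        ring
      · simp [Equiv.swap_apply_of_ne_of_ne h1 h2, h1, h2]
  have hn : (n : ℝ) ≠ 0 := by have := i.pos; positivity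
  rw [Finset.sum_congr rfl fun p hp => Finset.sum_congr rfl (key p hp)]
  simp only [Finset.sum_add_distrib, Finset.sum_sub_distrib, Finset.sum_const, card_fin_lt h,
    card_fin_ge h, Finset.sum_ite_eq, Finset.mem_filter, Finset.mem_univ, true_and, nsmul_eq_mul,
    Nat.cast_sub h, ← Finset.mul_sum, centredIndicator]
  by_cases hi : (i : ℕ) < r
  · simp only [hi, not_le.2 hi, if_true, if_false]
    field_simp
    ring
  · simp only [hi, not_lt.1 hi, if_true, if_false]
    field_simp
    ring

lemma sum_Q_centredIndicator {n r : ℕ} (h : r ≤ n) (i : Fin n) :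
    ∑ π, Q n r π * centredIndicator n r (π⁻¹ i) = (1 - 2 / n) * centredIndicator n r i := by
  have hn : (n : ℝ) ≠ 0 := by have := i.pos; positivity
  have hK : ((Finset.univ.filter fun κ => κ ∈ blockSubgroup n r).card : ℝ) =
      r.factorial * (n - r).factorial := by
    rw [← Nat.cast_mul, ← natCard_blockSubgroup h, ← Fintype.card_subtype,
      ← Nat.card_eq_fintype_card]
  have hQ : ∀ π, Q n r π * centredIndicator n r (π⁻¹ i) =
      (if π ∈ blockSubgroup n r then
        ((n^2 - 2*r*(n-r) : ℕ) : ℝ) / ((n^2 * (Nat.factorial r * Nat.factorial (n - r)) : ℕ) : ℝ)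
          * centredIndicator n r i else 0) +
      if crossProp n r π then
        2 / ((n^2 * (Nat.factorial r * Nat.factorial (n - r)) : ℕ) : ℝ)
          * centredIndicator n r (π⁻¹ i) else 0 := by
    intro π
    unfold Q
    by_cases h1 : π ∈ blockSubgroup n r
    · have h2 : ¬ crossProp n r π := fun h2 => h2.notMem h1
      rw [centredIndicator_comp_inv h1]
      simp [h1, h2]
    · by_cases h2 : crossProp n r π <;> simp [h1, h2]
  have hswap : ∀ p q : Fin n, ∀ κ ∈ Finset.univ.filter (fun κ => κ ∈ blockSubgroup n r),
      centredIndicator n r ((Equiv.swap p q * κ)⁻¹ i) =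
        centredIndicator n r (Equiv.swap p q i) := by
    intro p q κ hκ
    rw [mul_inv_rev, Equiv.Perm.mul_apply, centredIndicator_comp_inv (Finset.mem_filter.1 hκ).2,
      Equiv.swap_inv]
  rw [Finset.sum_congr rfl fun π _ => hQ π, Finset.sum_add_distrib, ← Finset.sum_filter,
    ← Finset.sum_filter, ← Finset.mul_sum, ← Finset.mul_sum, sum_crossProp,
    Finset.sum_congr rfl fun p _ => Finset.sum_congr rfl fun q _ =>
      Finset.sum_congr rfl (hswap p q)]
  simp only [Finset.sum_const, nsmul_eq_mul, ← Finset.mul_sum, hK, sum_swap_centredIndicator h]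
  have hle : 2 * r * (n - r) ≤ n ^ 2 := by
    obtain ⟨m, rfl⟩ := Nat.exists_eq_add_of_le h
    rw [Nat.add_sub_cancel_left]
    nlinarith [sq_nonneg ((r : ℤ) - m)]
  have h1 : (r.factorial : ℝ) ≠ 0 := by positivity
  have h2 : ((n - r).factorial : ℝ) ≠ 0 := by positivity
  push_cast [Nat.cast_sub hle, Nat.cast_sub h]
  field_simp
  ring

section Convolution

variable {G : Type*} [Group G] [Fintype G]

lemma sum_conv_mul (μ ν φ : G → ℝ) :
    ∑ g, conv μ ν g * φ g = ∑ h, μ h * ∑ g, ν g * φ (h * g) := by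
  simp only [conv, Finset.sum_mul, Finset.mul_sum]
  rw [Finset.sum_comm]
  refine Finset.sum_congr rfl fun h _ => ?_
  rw [← Equiv.sum_comp (Equiv.mulLeft h)]
  simp [mul_assoc]

lemma sum_induced_mul (H : Subgroup G) (μ : G → ℝ) (f : G ⧸ H → ℝ) :
    ∑ x, induced H μ x * f x = ∑ g, μ g * f g := by
  simp only [induced, Finset.sum_mul]
  rw [Finset.sum_comm]
  simp [ite_mul]

lemma sum_coe_quotient (H : Subgroup G) (f : G ⧸ H → ℝ) :
    ∑ g : G, f g = Nat.card H * ∑ x, f x := by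
  have h1 : ∀ g : G, (Subgroup.groupEquivQuotientProdSubgroup (s := H) g).1 = (g : G ⧸ H) :=
    fun _ => rfl
  simp_rw [← h1]
  rw [Equiv.sum_comp (Subgroup.groupEquivQuotientProdSubgroup (s := H)) (fun x => f x.1),
    Fintype.sum_prod_type]
  simp [Finset.mul_sum]

end Convolution

lemma sum_convPow_Q_centredIndicator {n r : ℕ} (h : r ≤ n) (k : ℕ) (i : Fin n) :
    ∑ π, convPow (Q n r) k π * centredIndicator n r (π⁻¹ i) =
      (1 - 2 / n) ^ k * centredIndicator n r i := by
  induction k generalizing i with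
  | zero =>
    simp only [convPow, ite_mul, one_mul, zero_mul, Finset.sum_ite_eq', Finset.mem_univ, if_true,
      inv_one, Equiv.Perm.one_apply, pow_zero]
  | succ k ih =>
    rw [convPow, sum_conv_mul]
    simp only [mul_inv_rev, Equiv.Perm.mul_apply, ih]
    simp only [mul_left_comm (Q n r _), ← Finset.mul_sum, sum_Q_centredIndicator h]
    ring

section Correlation

variable {ι : Type*} [Fintype ι] [DecidableEq ι]

lemma sum_perm_mul_apply (v : ι → ℝ) (h : Equiv.Perm ι) (i j : ι) :
    ∑ g : Equiv.Perm ι, v (g⁻¹ (h i)) * v (g⁻¹ (h j)) =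
      ∑ g : Equiv.Perm ι, v (g⁻¹ i) * v (g⁻¹ j) := by
  rw [← Equiv.sum_comp (Equiv.mulLeft h)]
  simp

lemma card_mul_sum_perm_sq (v : ι → ℝ) (i : ι) :
    Fintype.card ι * ∑ g : Equiv.Perm ι, v (g⁻¹ i) * v (g⁻¹ i) =
      (Fintype.card ι).factorial * ∑ j, v j ^ 2 := by
  have h1 : ∀ j, ∑ g : Equiv.Perm ι, v (g⁻¹ j) * v (g⁻¹ j) =
      ∑ g : Equiv.Perm ι, v (g⁻¹ i) * v (g⁻¹ i) := fun j => by
    simpa only [Equiv.swap_apply_left] using sum_perm_mul_apply v (Equiv.swap i j) i i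
  have h2 : ∑ j, ∑ g : Equiv.Perm ι, v (g⁻¹ j) * v (g⁻¹ j) =
      (Fintype.card ι).factorial * ∑ j, v j ^ 2 := by
    rw [Finset.sum_comm, ← Fintype.card_perm]
    simp only [← sq, Equiv.sum_comp (_ : Equiv.Perm ι) (fun j => v j ^ 2)]
    simp
  rw [← h2, Finset.sum_congr rfl fun j _ => h1 j]
  simp

lemma sum_perm_mul_of_ne {v : ι → ℝ} (hv : ∑ i, v i = 0) {i j : ι} (hij : i ≠ j) :
    ((Fintype.card ι : ℝ) - 1) * ∑ g : Equiv.Perm ι, v (g⁻¹ i) * v (g⁻¹ j) =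
      -∑ g : Equiv.Perm ι, v (g⁻¹ i) * v (g⁻¹ i) := by
  have h1 : ∀ l ∈ Finset.univ.erase i, ∑ g : Equiv.Perm ι, v (g⁻¹ i) * v (g⁻¹ l) =
      ∑ g : Equiv.Perm ι, v (g⁻¹ i) * v (g⁻¹ j) := fun l hl => by
    simpa [Equiv.swap_apply_of_ne_of_ne hij (Finset.ne_of_mem_erase hl).symm] using
      sum_perm_mul_apply v (Equiv.swap j l) i j
  have h2 : ∑ l, ∑ g : Equiv.Perm ι, v (g⁻¹ i) * v (g⁻¹ l) = 0 := by
    rw [Finset.sum_comm]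
    refine Finset.sum_eq_zero fun g _ => ?_
    rw [← Finset.mul_sum, Equiv.sum_comp g⁻¹ v, hv, mul_zero]
  rw [← Finset.add_sum_erase _ _ (Finset.mem_univ i), Finset.sum_congr rfl h1, Finset.sum_const,
    Finset.card_erase_of_mem (Finset.mem_univ i), Finset.card_univ, nsmul_eq_mul,
    Nat.cast_sub (Fintype.card_pos_iff.2 ⟨i⟩), Nat.cast_one] at h2
  linarith

/-- Schur orthogonality for the matrix coefficient of a sum-zero vector in the permutation
representation. -/
lemma sum_perm_inner_sq {v : ι → ℝ} (hv : ∑ i, v i = 0) :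
    ((Fintype.card ι : ℝ) - 1) * ∑ g : Equiv.Perm ι, (∑ i, v (g⁻¹ i) * v i) ^ 2 =
      (Fintype.card ι).factorial * (∑ i, v i ^ 2) ^ 2 := by
  set N : ℝ := (Fintype.card ι : ℝ) with hN
  set F : ℝ := ((Fintype.card ι).factorial : ℝ) with hF
  set s := ∑ i, v i ^ 2 with hs
  have h1 : ∑ g : Equiv.Perm ι, (∑ i, v (g⁻¹ i) * v i) ^ 2 =
      ∑ i, ∑ j, (∑ g : Equiv.Perm ι, v (g⁻¹ i) * v (g⁻¹ j)) * (v i * v j) := by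
    simp only [sq, Finset.sum_mul, Finset.mul_sum]
    rw [Finset.sum_comm]
    refine Finset.sum_congr rfl fun i _ => ?_
    rw [Finset.sum_comm]
    refine Finset.sum_congr rfl fun j _ => Finset.sum_congr rfl fun g _ => ?_
    ring
  have h2 : ∀ i j, (N - 1) * ∑ g : Equiv.Perm ι, v (g⁻¹ i) * v (g⁻¹ j) =
      (if i = j then F * s else 0) - ∑ g : Equiv.Perm ι, v (g⁻¹ i) * v (g⁻¹ i) := by
    intro i j
    split_ifs with h
    · subst h
      rw [← card_mul_sum_perm_sq v i]
      ring
    · rw [sum_perm_mul_of_ne hv h, zero_sub]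
  rw [h1, Finset.mul_sum]
  have h3 : ∀ i, (N - 1) * ∑ j, (∑ g : Equiv.Perm ι, v (g⁻¹ i) * v (g⁻¹ j)) * (v i * v j) =
      F * s * v i ^ 2 := by
    intro i
    rw [Finset.mul_sum]
    simp only [← mul_assoc, h2, sub_mul, Finset.sum_sub_distrib, ite_mul, zero_mul]
    rw [← Finset.mul_sum, hv, Finset.sum_ite_eq]
    simp
    ring
  rw [Finset.sum_congr rfl fun i _ => h3 i, ← Finset.mul_sum]
  ring

lemma sum_perm_inner {v : ι → ℝ} (hv : ∑ i, v i = 0) :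
    ∑ g : Equiv.Perm ι, ∑ i, v (g⁻¹ i) * v i = 0 := by
  have h1 : ∀ i j, ∑ g : Equiv.Perm ι, v (g⁻¹ i) = ∑ g : Equiv.Perm ι, v (g⁻¹ j) := fun i j => by
    rw [← Equiv.sum_comp (Equiv.mulLeft (Equiv.swap i j))]
    simp
  rw [Finset.sum_comm]
  rcases isEmpty_or_nonempty ι with _ | ⟨⟨j⟩⟩
  · simp
  · simp only [← Finset.sum_mul, h1 _ j, ← Finset.mul_sum, hv, mul_zero]

end Correlation

/-- The spherical function `gK ↦ ⟨g v, v⟩` on the coset space, `v` the centred indicator. -/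
def sphericalFun (n r : ℕ) (x : Equiv.Perm (Fin n) ⧸ blockSubgroup n r) : ℝ :=
  ∑ i, centredIndicator n r (x.out⁻¹ i) * centredIndicator n r i

lemma sphericalFun_coe {n r : ℕ} (g : Equiv.Perm (Fin n)) :
    sphericalFun n r (g : Equiv.Perm (Fin n) ⧸ blockSubgroup n r) =
      ∑ i, centredIndicator n r (g⁻¹ i) * centredIndicator n r i := by
  obtain ⟨κ, hκ⟩ := QuotientGroup.mk_out_eq_mul (blockSubgroup n r) g
  simp only [sphericalFun, hκ, mul_inv_rev, Equiv.Perm.mul_apply,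
    centredIndicator_comp_inv κ.2]

/-- the ℓ² lower bound
`C(n,r)·‖Q̃^{*k} − Ũ‖₂² ≥ (n−1)·(1 − 2/n)^{2k}` for the variant model. -/
theorem variant_l2_lower_bound (n r : ℕ) (hn : 2 ≤ n) (hr : 1 ≤ r)
    (hrn : 2 * r ≤ n) (k : ℕ) :
    ((n : ℝ) - 1) * (1 - 2/(n : ℝ))^(2*k) ≤
      (n.choose r : ℝ) *
        (l2 (induced (blockSubgroup n r) (convPow (Q n r) k))
            (unif (Equiv.Perm (Fin n) ⧸ blockSubgroup n r)))^2 := by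
  have hle : r ≤ n := by omega
  set s : ℝ := ∑ i, centredIndicator n r i ^ 2 with hs
  have hv := sum_centredIndicator (n := n) (r := r) (by omega) hle
  have hK : (0 : ℝ) < Nat.card (blockSubgroup n r) := by exact_mod_cast Nat.card_pos
  have hspos : 0 < s := by
    have hlt : 0 < centredIndicator n r ⟨0, by omega⟩ := by
      have : (r : ℝ) / n < 1 := by
        rw [div_lt_one (by positivity)]
        exact_mod_cast (by omega : r < n)
      simp only [centredIndicator, show 0 < r by omega, if_true]
      linarith
    exact Finset.sum_pos' (fun i _ => sq_nonneg _) ⟨_, Finset.mem_univ _, pow_pos hlt 2⟩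
  have hmean : ∑ x, sphericalFun n r x = 0 := by
    have h1 := sum_coe_quotient (blockSubgroup n r) (sphericalFun n r)
    simp only [sphericalFun_coe, sum_perm_inner hv] at h1
    exact (mul_eq_zero.1 h1.symm).resolve_left hK.ne'
  have hchoose : (n.choose r : ℝ) * Nat.card (blockSubgroup n r) = n.factorial := by
    rw [natCard_blockSubgroup hle, ← Nat.cast_mul, ← mul_assoc,
      Nat.choose_mul_factorial_mul_factorial hle]
  have hnorm : ((n : ℝ) - 1) * ∑ x, sphericalFun n r x ^ 2 = n.choose r * s ^ 2 := by
    have h1 := sum_coe_quotient (blockSubgroup n r) (fun x => sphericalFun n r x ^ 2)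
    have h2 := sum_perm_inner_sq hv
    simp only [sphericalFun_coe] at h1
    rw [h1, Fintype.card_fin, ← hchoose] at h2
    refine mul_left_cancel₀ hK.ne' ?_
    linear_combination h2
  have hwalk : ∑ x, sphericalFun n r x *
      (induced (blockSubgroup n r) (convPow (Q n r) k) x - unif _ x) = (1 - 2 / n) ^ k * s := by
    simp only [mul_sub, Finset.sum_sub_distrib, unif]
    rw [← Finset.sum_mul, hmean, zero_mul, sub_zero]
    simp only [mul_comm (sphericalFun n r _)]
    rw [sum_induced_mul]
    simp only [sphericalFun_coe, Finset.mul_sum, hs]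
    rw [Finset.sum_comm]
    refine Finset.sum_congr rfl fun i _ => ?_
    simp only [← mul_assoc]
    rw [← Finset.sum_mul, sum_convPow_Q_centredIndicator hle]
    ring
  have hcs := Finset.sum_mul_sq_le_sq_mul_sq Finset.univ (sphericalFun n r)
    (fun x => induced (blockSubgroup n r) (convPow (Q n r) k) x -
      unif (Equiv.Perm (Fin n) ⧸ blockSubgroup n r) x)
  rw [hwalk] at hcs
  rw [l2, Real.sq_sqrt (Finset.sum_nonneg fun _ _ => sq_nonneg _)]
  have hn1 : (0 : ℝ) ≤ (n : ℝ) - 1 := by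
    have : (2 : ℝ) ≤ n := by exact_mod_cast hn
    linarith
  have h3 := mul_le_mul_of_nonneg_left hcs hn1
  rw [← mul_assoc _ (∑ x, sphericalFun n r x ^ 2), hnorm] at h3
  refine le_of_mul_le_mul_right ?_ (pow_pos hspos 2)
  calc _ = ((n : ℝ) - 1) * ((1 - 2 / (n : ℝ)) ^ k * s) ^ 2 := by ring
    _ ≤ _ := h3
    _ = _ := by ring

end BL
end
end
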